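/- arXiv:2012.09824 — 3 statements merged into one kernel-verified Lean document; each statement's English description precedes it below -/
import Mathlib

section
/- Let Δ, k ≥ 2, d ≥ 1, β ∈ (0, 1), and let (T, r, L) be a layered tight k-tree with t ≥ 2Δ^d β^{−1} edges and Δ_1(T) ≤ Δ. Then (T, r, L) has a (β, d)-decomposition: a tuple (D_i, s_i)_{1 ≤ i ≤ m} of rooted k-subtrees of T such that (1) m ≤ 2Δ^d/β; (2) E(T) is the disjoint union of the sets E(D_i); (3) |E(D_i)| ≤ β|E(T)| for each i; (4) s_1 = r and each s_i is L-layered; (5) (V(D_ℓ) \ s_ℓ) ∩ V(D_i) = ∅ for all 1 ≤ i < ℓ ≤ m; (6) for each 2 ≤ ℓ ≤ m there is i < ℓ such that s_ℓ ∈ ∂D_i and the rank of s_ℓ in D_i, in the layering of D_i inherited from L, is at least d. -/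
open Finset

attribute [local instance] Classical.propDecidable

variable {α : Type*}

/-- The degree of a vertex `v` in a hypergraph `T`: the number of edges containing `v`. -/
def vdeg [DecidableEq α] (T : Finset (Finset α)) (v : α) : ℕ :=
  (T.filter fun e => v ∈ e).card

/-- The vertex set of a hypergraph: the union of its edges. -/
def hverts [DecidableEq α] (T : Finset (Finset α)) : Finset α := T.sup id

/-- The maximum 1-degree of a hypergraph. -/
def hmaxDeg [DecidableEq α] (T : Finset (Finset α)) : ℕ := (hverts T).sup (vdeg T)

/-- `es` is a valid ordering of the edges of a tight `k`-tree: every edge is a `k`-set, and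
every edge except the first contains a vertex `v` not in any previous edge with the rest of
the edge contained in some previous edge. -/
def ValidOrdering [DecidableEq α] (k : ℕ) (es : List (Finset α)) : Prop :=
  (∀ e ∈ es, e.card = k) ∧
  ∀ i, 0 < i → i < es.length →
    ∃ v ∈ es.getD i ∅,
      (∀ j, j < i → v ∉ es.getD j ∅) ∧
      ∃ j, j < i ∧ (es.getD i ∅) \ {v} ⊆ es.getD j ∅

/-- `T` is a tight `k`-tree: its edges admit a valid ordering. -/
def IsTightTree [DecidableEq α] (k : ℕ) (T : Finset (Finset α)) : Prop :=
  ∃ es : List (Finset α), es ≠ [] ∧ es.Nodup ∧ es.toFinset = T ∧ ValidOrdering k es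

/-- `f` belongs to the shadow of the `k`-graph `H`. -/
def InShadow [DecidableEq α] (k : ℕ) (H : Finset (Finset α)) (f : Finset α) : Prop :=
  f.card = k - 1 ∧ ∃ e ∈ H, f ⊆ e

/-- `H` contains (a copy of) `T`. -/
def Contains {β : Type*} [DecidableEq α] [DecidableEq β]
    (H : Finset (Finset α)) (T : Finset (Finset β)) : Prop :=
  ∃ φ : β → α, Function.Injective φ ∧ ∀ e ∈ T, e.image φ ∈ H

/-- `(L 1, …, L m)` is a layering for the rooted tight `k`-tree `(T, r)`. -/
structure IsLayering [DecidableEq α] (k : ℕ) (T : Finset (Finset α)) (r : Finset α)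
    (m : ℕ) (L : ℕ → Finset α) : Prop where
  /-- every layer is nonempty -/
  nonempty : ∀ i, 1 ≤ i → i ≤ m → (L i).Nonempty
  /-- every layer consists of vertices of `T` -/
  layer_subset : ∀ i, 1 ≤ i → i ≤ m → L i ⊆ hverts T
  /-- the layers are pairwise disjoint -/
  layer_disjoint : ∀ i j, 1 ≤ i → i ≤ m → 1 ≤ j → j ≤ m → i ≠ j → Disjoint (L i) (L j)
  /-- the layers cover `V(T)` -/
  cover : ∀ v ∈ hverts T, ∃ i, 1 ≤ i ∧ i ≤ m ∧ v ∈ L i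
  /-- `|r ∩ L i| = 1` for all `i ∈ [k−1]` -/
  root_inter : ∀ i, 1 ≤ i → i ≤ k - 1 → (r ∩ L i).card = 1
  /-- `|L 1| = 1` -/
  first_card : (L 1).card = 1
  /-- every vertex of `L (i+1)` shares an edge with some vertex of `L i` -/
  link : ∀ i, 1 ≤ i → i < m → ∀ v ∈ L (i + 1), ∃ w ∈ L i, ∃ e ∈ T, v ∈ e ∧ w ∈ e
  /-- every edge meets `k` consecutive layers, each exactly once -/
  window : ∀ e ∈ T, ∃ j, 1 ≤ j ∧ j + (k - 1) ≤ m ∧ ∀ i, j ≤ i → i < j + k → (e ∩ L i).card = 1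

/-- `x` is `L`-layered with rank `j`: `x` meets each of the `k − 1` consecutive layers
`L j, …, L (j + k − 2)` exactly once. -/
def LayeredRank [DecidableEq α] (k : ℕ) (L : ℕ → Finset α) (x : Finset α) (j : ℕ) : Prop :=
  1 ≤ j ∧ ∀ i, j ≤ i → i ≤ j + (k - 2) → (x ∩ L i).card = 1

/-- The nearest ancestor-or-self of `i` (along the parent map `p`) lying in `R` (or the root). -/
noncomputable def rho (p : ℕ → ℕ) (R : Finset ℕ) (i : ℕ) : ℕ :=
  if _h : p i < i ∧ i ∉ R then rho p R (p i) else i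
termination_by i
decreasing_by exact _h.1

section Rho

variable {p : ℕ → ℕ}

theorem rho_of_mem {R : Finset ℕ} {i : ℕ} (h : i ∈ R) : rho p R i = i := by
  rw [rho]; simp [h]

theorem rho_zero (R : Finset ℕ) : rho p R 0 = 0 := by
  rw [rho]; simp

theorem rho_step (hp : ∀ i, 0 < i → p i < i) {R : Finset ℕ} {i : ℕ} (h0 : 0 < i) (h : i ∉ R) :
    rho p R i = rho p R (p i) := by
  rw [rho]; simp [h, hp i h0]

theorem rho_le (hp : ∀ i, 0 < i → p i < i) (R : Finset ℕ) (i : ℕ) : rho p R i ≤ i := by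
  induction i using Nat.strong_induction_on with
  | _ i ih =>
    rcases Nat.eq_zero_or_pos i with rfl | h0
    · simp [rho_zero]
    · by_cases h : i ∈ R
      · simp [rho_of_mem h]
      · rw [rho_step hp h0 h]
        exact (ih _ (hp i h0)).trans (hp i h0).le

theorem rho_mem (hp : ∀ i, 0 < i → p i < i) (R : Finset ℕ) (i : ℕ) :
    rho p R i ∈ R ∨ rho p R i = 0 := by
  induction i using Nat.strong_induction_on with
  | _ i ih =>
    rcases Nat.eq_zero_or_pos i with rfl | h0
    · simp [rho_zero]
    · by_cases h : i ∈ R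
      · simp [rho_of_mem h, h]
      · rw [rho_step hp h0 h]
        exact ih _ (hp i h0)

theorem rho_single (hp : ∀ i, 0 < i → p i < i) {R : Finset ℕ} {z : ℕ} (i : ℕ)
    (h : rho p R i = z) : rho p {z} i = z := by
  induction i using Nat.strong_induction_on with
  | _ i ih =>
    by_cases hz : i = z
    · subst hz; exact rho_of_mem (by simp)
    rcases Nat.eq_zero_or_pos i with rfl | h0
    · rw [rho_zero] at h; exact absurd h hz
    · by_cases hR : i ∈ R
      · rw [rho_of_mem hR] at h; exact absurd h hz
      · rw [rho_step hp h0 hR] at h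
        rw [rho_step hp h0 (by simpa using hz)]
        exact ih _ (hp i h0) h

theorem rho_block (hp : ∀ i, 0 < i → p i < i) {R C U : Finset ℕ} {x : ℕ}
    (hx : x ∈ C ∨ x = 0) (hU : ∀ i ∈ U, 0 < i → p i ∈ U)
    (hch : ∀ c ∈ C, c ∈ U → rho p C (p c) = x → c ∈ R) (i : ℕ) (hi : i ∈ U)
    (h : rho p R i = x) : rho p C i = x := by
  induction i using Nat.strong_induction_on with
  | _ i ih =>
    by_cases hz : i = x
    · subst hz
      rcases hx with hx | rfl
      · exact rho_of_mem hx
      · exact rho_zero _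
    rcases Nat.eq_zero_or_pos i with rfl | h0
    · rw [rho_zero] at h; exact absurd h hz
    · by_cases hR : i ∈ R
      · rw [rho_of_mem hR] at h; exact absurd h hz
      · rw [rho_step hp h0 hR] at h
        have h1 := ih _ (hp i h0) (hU i hi h0) h
        by_cases hC : i ∈ C
        · exact absurd (hch i hC hi h1) hR
        · rw [rho_step hp h0 hC, h1]

theorem rho_desc (hp : ∀ i, 0 < i → p i < i) {R : Finset ℕ} {x : ℕ} (hx : x ∈ R) (i : ℕ)
    (h : rho p {x} i = x) : rho p {x} (rho p R i) = x := by
  induction i using Nat.strong_induction_on with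
  | _ i ih =>
    by_cases hR : i ∈ R
    · rw [rho_of_mem hR, h]
    · have hz : i ≠ x := by rintro rfl; exact hR hx
      rcases Nat.eq_zero_or_pos i with rfl | h0
      · rw [rho_zero] at h ⊢; rwa [rho_zero]
      · rw [rho_step hp h0 hR]
        rw [rho_step hp h0 (by simpa using hz)] at h
        exact ih _ (hp i h0) h

theorem rho_congr (hp : ∀ i, 0 < i → p i < i) {R R' U : Finset ℕ}
    (hU : ∀ i ∈ U, 0 < i → p i ∈ U) (hR : ∀ i ∈ U, i ∈ R ↔ i ∈ R') (i : ℕ) (hi : i ∈ U) :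
    rho p R i = rho p R' i := by
  induction i using Nat.strong_induction_on with
  | _ i ih =>
    rcases Nat.eq_zero_or_pos i with rfl | h0
    · simp [rho_zero]
    · by_cases h : i ∈ R
      · rw [rho_of_mem h, rho_of_mem ((hR i hi).1 h)]
      · rw [rho_step hp h0 h, rho_step hp h0 (fun h' => h ((hR i hi).2 h'))]
        exact ih _ (hp i h0) (hU i hi h0)

theorem rho_partition (hp : ∀ i, 0 < i → p i < i) (C : Finset ℕ) (N : ℕ) (M : ℝ) (t : ℕ)
    (hM : 0 < M) (h0C : 0 ∉ C)
    (hblock : ∀ x, x ∈ C ∨ x = 0 →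
      (((range t).filter (fun i => rho p C i = x)).card : ℝ) ≤ M)
    (hch : ∀ x, x ∈ C ∨ x = 0 → (C.filter (fun c => rho p C (p c) = x)).card ≤ N) :
    ∀ n, ∀ U ⊆ range t, U.card ≤ n → 0 ∈ U → (∀ i ∈ U, 0 < i → p i ∈ U) →
      ∃ R ⊆ C, R ⊆ U ∧ (∀ x, ((U.filter (fun i => rho p R i = x)).card : ℝ) ≤ M) ∧
        M * R.card ≤ (N + 1) * U.card := by
  intro n
  induction n with
  | zero =>
    intro U hUt hc h0 hU
    have : U = ∅ := by simpa using hc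
    simp [this] at h0
  | succ n ih =>
    intro U hUt hc h0 hU
    by_cases hbig : (U.card : ℝ) ≤ M
    · refine ⟨∅, by simp, by simp, fun x => ?_, by simp; positivity⟩
      refine le_trans ?_ hbig
      exact_mod_cast card_le_card (filter_subset _ _)
    push Not at hbig
    set X := U.filter (fun x => (x ∈ C ∨ x = 0) ∧
      M < ((U.filter (fun i => rho p {x} i = x)).card : ℝ)) with hX
    have h0X : 0 ∈ X := by
      rw [hX, mem_filter]
      refine ⟨h0, Or.inr rfl, ?_⟩
      have : U.filter (fun i => rho p {0} i = 0) = U := by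
        apply filter_true_of_mem
        intro i _
        rcases rho_mem hp {0} i with h | h
        · simpa using h
        · exact h
      rw [this]; exact hbig
    obtain ⟨x, hxX, hxmax⟩ : ∃ x ∈ X, ∀ y ∈ X, y ≤ x := ⟨X.max' ⟨0, h0X⟩, X.max'_mem _, fun y hy => X.le_max' y hy⟩
    rw [hX, mem_filter] at hxX
    obtain ⟨hxU, hxC, hxM⟩ := hxX
    set Y := (C ∩ U).filter (fun c => rho p C (p c) = x) with hY
    have hYC : ∀ y ∈ Y, y ∈ C ∧ y ∈ U ∧ rho p C (p y) = x := by
      intro y hy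
      rw [hY, mem_filter, mem_inter] at hy
      exact ⟨hy.1.1, hy.1.2, hy.2⟩
    have hpos : ∀ y ∈ C, 0 < y := fun y hy => Nat.pos_of_ne_zero (by rintro rfl; exact h0C hy)
    have hYx : ∀ y ∈ Y, x < y := by
      intro y hy
      obtain ⟨h1, h2, h3⟩ := hYC y hy
      have := rho_le hp C (p y)
      have := hp y (hpos y h1)
      omega
    have hYN : Y.card ≤ N := by
      refine le_trans (card_le_card ?_) (hch x hxC)
      intro y hy
      obtain ⟨h1, h2, h3⟩ := hYC y hy
      exact mem_filter.2 ⟨h1, h3⟩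
    have hYM : ∀ (R : Finset ℕ), ∀ y ∈ Y, ((U.filter (fun i => rho p R i = y)).card : ℝ) ≤ M := by
      intro R y hy
      obtain ⟨h1, h2, h3⟩ := hYC y hy
      have hnot : y ∉ X := fun h => absurd (hxmax y h) (by have := hYx y hy; omega)
      rw [hX, mem_filter] at hnot
      push Not at hnot
      refine le_trans ?_ (hnot h2 (Or.inl h1))
      have : U.filter (fun i => rho p R i = y) ⊆ U.filter (fun i => rho p {y} i = y) := by
        intro i hi
        rw [mem_filter] at hi ⊢
        exact ⟨hi.1, rho_single hp i hi.2⟩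
      exact_mod_cast card_le_card this
    have hxB : ∀ (R : Finset ℕ), Y ⊆ R →
        ((U.filter (fun i => rho p R i = x)).card : ℝ) ≤ M := by
      intro R hR
      refine le_trans ?_ (hblock x hxC)
      have : U.filter (fun i => rho p R i = x) ⊆ (range t).filter (fun i => rho p C i = x) := by
        intro i hi
        rw [mem_filter] at hi ⊢
        refine ⟨hUt hi.1, rho_block hp hxC hU ?_ i hi.1 hi.2⟩
        intro c hc1 hc2 hc3
        exact hR (mem_filter.2 ⟨mem_inter.2 ⟨hc1, hc2⟩, hc3⟩)
      exact_mod_cast card_le_card this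
    by_cases hx0 : x = 0
    · refine ⟨Y, fun y hy => (hYC y hy).1, fun y hy => (hYC y hy).2.1, ?_, ?_⟩
      · intro z
        by_cases hz : z ∈ Y
        · exact hYM _ z hz
        by_cases hz0 : z = x
        · subst hz0; exact hxB Y (Subset.refl _)
        · have : U.filter (fun i => rho p Y i = z) = ∅ := by
            apply filter_false_of_mem
            rintro i _ rfl
            rcases rho_mem hp Y i with h | h
            · exact hz h
            · exact hz0 (h.trans hx0.symm)
          rw [this]; simpa using hM.le
      · have h1 : (Y.card : ℝ) ≤ N + 1 := by
          have : (Y.card : ℝ) ≤ N := by exact_mod_cast hYN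
          linarith
        rw [mul_comm]
        exact mul_le_mul h1 hbig.le hM.le (by positivity)
    · set U' := U.filter (fun i => ¬ rho p {x} i = x) with hU'
      have hsplit : (U.filter (fun i => rho p {x} i = x)).card + U'.card = U.card :=
        card_filter_add_card_filter_not _
      have hxU' : x ∉ U' := by
        rw [hU', mem_filter]; simp [rho_of_mem]
      have hlt : U'.card < U.card := card_lt_card ⟨filter_subset _ _, fun h => hxU' (h hxU)⟩
      have h0U' : 0 ∈ U' := by
        rw [hU', mem_filter]
        refine ⟨h0, ?_⟩
        rw [rho_zero]; exact fun h => hx0 h.symm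
      have hcl : ∀ i ∈ U', 0 < i → p i ∈ U' := by
        intro i hi hi0
        rw [hU', mem_filter] at hi ⊢
        refine ⟨hU i hi.1 hi0, ?_⟩
        have hne : i ≠ x := by
          rintro rfl; exact hi.2 (rho_of_mem (by simp))
        have := hi.2
        rwa [rho_step hp hi0 (by simpa using hne)] at this
      obtain ⟨R', hR'C, hR'U, hR'M, hR'c⟩ :=
        ih U' ((filter_subset _ _).trans hUt) (by omega) h0U' hcl
      have hxC' : x ∈ C := hxC.resolve_right hx0
      have hYU' : ∀ y ∈ Y, y ∉ U' := by
        intro y hy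
        obtain ⟨h1, h2, h3⟩ := hYC y hy
        rw [hU', mem_filter]
        rintro ⟨_, h⟩
        apply h
        have hne : y ≠ x := (hYx y hy).ne'
        rw [rho_step hp (hpos y h1) (by simpa using hne)]
        exact rho_single hp _ h3
      set R := R' ∪ insert x Y with hR
      have hRmem : ∀ i, i ∈ R ↔ i ∈ R' ∨ i = x ∨ i ∈ Y := by
        intro i; rw [hR, mem_union, mem_insert]
      refine ⟨R, ?_, ?_, ?_, ?_⟩
      · intro i hi
        rcases (hRmem i).1 hi with h | rfl | h
        · exact hR'C h
        · exact hxC'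
        · exact (hYC i h).1
      · intro i hi
        rcases (hRmem i).1 hi with h | rfl | h
        · exact (mem_filter.1 (hR'U h)).1
        · exact hxU
        · exact (hYC i h).2.1
      · intro z
        by_cases hzx : z = x
        · subst hzx
          exact hxB R (fun y hy => (hRmem y).2 (Or.inr (Or.inr hy)))
        by_cases hzY : z ∈ Y
        · exact hYM R z hzY
        refine le_trans ?_ (hR'M z)
        have : U.filter (fun i => rho p R i = z) ⊆ U'.filter (fun i => rho p R' i = z) := by
          intro i hi
          rw [mem_filter] at hi
          have hiU' : i ∈ U' := by
            by_contra hcon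
            rw [hU', mem_filter] at hcon
            have hd : rho p {x} i = x := by
              by_contra h; exact hcon ⟨hi.1, h⟩
            have h1 := rho_desc hp ((hRmem x).2 (Or.inr (Or.inl rfl))) i hd
            rw [hi.2] at h1
            rcases rho_mem hp R i with h | h
            · rw [hi.2, hRmem] at h
              rcases h with h | h | h
              · exact (mem_filter.1 (hR'U h)).2 h1
              · exact hzx h
              · exact hzY h
            · rw [hi.2] at h
              rw [h, rho_zero] at h1
              exact hx0 h1.symm
          rw [mem_filter]
          refine ⟨hiU', ?_⟩
          rw [← hi.2]
          refine (rho_congr hp hcl ?_ i hiU').symm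
          intro j hj
          rw [hRmem]
          constructor
          · rintro (h | rfl | h)
            · exact h
            · exact absurd hj hxU'
            · exact absurd hj (hYU' j h)
          · exact Or.inl
        exact_mod_cast card_le_card this
      · have h1 : R.card ≤ R'.card + (N + 1) := by
          refine (card_union_le _ _).trans ?_
          have := card_insert_le x Y
          omega
        have h2 : (R.card : ℝ) ≤ R'.card + (N + 1) := by exact_mod_cast h1
        have h3 : ((U.filter (fun i => rho p {x} i = x)).card : ℝ) + U'.card = U.card := by
          exact_mod_cast hsplit
        have h4 : M * R.card ≤ M * (R'.card + (N + 1)) := mul_le_mul_of_nonneg_left h2 hM.le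
        have h5 : M * (N + 1 : ℝ) ≤
            (U.filter (fun i => rho p {x} i = x)).card * (N + 1 : ℝ) :=
          mul_le_mul_of_nonneg_right hxM.le (by positivity)
        rw [← h3]
        linarith

end Rho

section Trees

theorem getD_mem_of_lt {l : List (Finset α)} {j : ℕ} (h : j < l.length) : l.getD j ∅ ∈ l := by
  rw [List.getD_eq_getElem _ _ h]; exact List.getElem_mem h

theorem exists_getD_of_mem {l : List (Finset α)} {f : Finset α} (h : f ∈ l) :
    ∃ j, j < l.length ∧ l.getD j ∅ = f := by
  obtain ⟨j, hj, rfl⟩ := List.getElem_of_mem h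
  exact ⟨j, hj, List.getD_eq_getElem _ _ hj⟩

theorem valid_append [DecidableEq α] {k : ℕ} {l : List (Finset α)} {e : Finset α} {v : α}
    (hl : ValidOrdering k l) (he : e.card = k) (hv : v ∈ e) (hn : ∀ f ∈ l, v ∉ f)
    (hf : ∃ f ∈ l, e \ {v} ⊆ f) : ValidOrdering k (l ++ [e]) := by
  refine ⟨?_, ?_⟩
  · intro f hf'
    rcases List.mem_append.1 hf' with h | h
    · exact hl.1 f h
    · rw [List.mem_singleton.1 h]; exact he
  · intro i h0 hi
    have hi' : i < l.length + 1 := by simpa using hi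
    rcases Nat.lt_succ_iff_lt_or_eq.1 hi' with hlt | rfl
    · obtain ⟨u, hu, hun, j, hj, hjs⟩ := hl.2 i h0 hlt
      refine ⟨u, ?_, ?_, j, hj, ?_⟩
      · rwa [List.getD_append _ _ _ _ hlt]
      · intro j' hj'
        rw [List.getD_append _ _ _ _ (by omega)]
        exact hun j' hj'
      · rwa [List.getD_append _ _ _ _ hlt, List.getD_append _ _ _ _ (by omega)]
    · have hlast : (l ++ [e]).getD l.length ∅ = e := by
        rw [List.getD_append_right _ _ _ _ le_rfl]; simp
      rw [hlast]
      obtain ⟨f, hfl, hfs⟩ := hf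
      obtain ⟨j, hj, rfl⟩ := exists_getD_of_mem hfl
      refine ⟨v, hv, ?_, j, hj, ?_⟩
      · intro j' hj'
        rw [List.getD_append _ _ _ _ hj']
        exact hn _ (getD_mem_of_lt hj')
      · rwa [List.getD_append _ _ _ _ hj]

theorem valid_of_append [DecidableEq α] {k : ℕ} {l : List (Finset α)} {e : Finset α}
    (h : ValidOrdering k (l ++ [e])) (hl : l ≠ []) :
    ValidOrdering k l ∧ e.card = k ∧ ∃ v ∈ e, (∀ f ∈ l, v ∉ f) ∧ ∃ f ∈ l, e \ {v} ⊆ f := by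
  refine ⟨⟨fun f hf => h.1 f (by simp [hf]), ?_⟩, h.1 e (by simp), ?_⟩
  · intro i h0 hi
    obtain ⟨u, hu, hun, j, hj, hjs⟩ := h.2 i h0 (by simp; omega)
    rw [List.getD_append _ _ _ _ hi] at hu hjs
    rw [List.getD_append _ _ _ _ (by omega)] at hjs
    refine ⟨u, hu, ?_, j, hj, hjs⟩
    intro j' hj'
    have := hun j' hj'
    rwa [List.getD_append _ _ _ _ (by omega)] at this
  · have hlast : (l ++ [e]).getD l.length ∅ = e := by
      rw [List.getD_append_right _ _ _ _ le_rfl]; simp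
    obtain ⟨u, hu, hun, j, hj, hjs⟩ := h.2 l.length (List.length_pos_of_ne_nil hl) (by simp)
    rw [hlast] at hu hjs
    rw [List.getD_append _ _ _ _ hj] at hjs
    refine ⟨u, hu, ?_, _, getD_mem_of_lt hj, hjs⟩
    intro f hf
    obtain ⟨j', hj', rfl⟩ := exists_getD_of_mem hf
    have := hun j' hj'
    rwa [List.getD_append _ _ _ _ hj'] at this

theorem valid_cons [DecidableEq α] {k : ℕ} {l : List (Finset α)} {e f : Finset α} {v : α}
    (hl : ValidOrdering k (f :: l)) (he : e.card = k) (hv : v ∈ e)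
    (hn : ∀ g ∈ f :: l, v ∉ g) (hf : e \ {v} ⊆ f) : ValidOrdering k (e :: f :: l) := by
  have hfc : f.card = k := hl.1 f (by simp)
  refine ⟨?_, ?_⟩
  · intro g hg
    rcases List.mem_cons.1 hg with rfl | h
    · exact he
    · exact hl.1 g h
  · intro i h0 hi
    obtain ⟨i, rfl⟩ : ∃ i', i = i' + 1 := ⟨i - 1, by omega⟩
    rw [List.getD_cons_succ]
    rcases Nat.eq_zero_or_pos i with rfl | hi0
    · -- the second edge
      have hec : (e \ {v}).card = k - 1 := by
        rw [card_sdiff_of_subset (by simpa using hv)]; simp [he]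
      have hk : 0 < k := by rw [← he]; exact card_pos.2 ⟨v, hv⟩
      obtain ⟨w, hw⟩ : ∃ w, f \ (e \ {v}) = {w} := by
        apply card_eq_one.1
        rw [card_sdiff_of_subset hf]; omega
      have hwm : w ∈ f \ (e \ {v}) := by rw [hw]; simp
      have hwv : w ≠ v := by
        rintro rfl
        exact hn f (by simp) (mem_sdiff.1 hwm).1
      refine ⟨w, by simpa using (mem_sdiff.1 hwm).1, ?_, 0, by omega, ?_⟩
      · intro j hj
        have : j = 0 := by omega
        subst this
        simp only [List.getD_cons_zero]
        intro hwe
        exact (mem_sdiff.1 hwm).2 (mem_sdiff.2 ⟨hwe, by simpa using hwv⟩)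
      · simp only [List.getD_cons_zero]
        intro u hu
        rw [mem_sdiff] at hu
        by_contra hue
        have : u ∈ f \ (e \ {v}) := mem_sdiff.2 ⟨hu.1, fun h => hue (mem_sdiff.1 h).1⟩
        rw [hw] at this
        exact hu.2 this
    · obtain ⟨u, hu, hun, j, hj, hjs⟩ := hl.2 i hi0 (by simpa using hi)
      refine ⟨u, hu, ?_, j + 1, by omega, ?_⟩
      · intro j' hj'
        rcases Nat.eq_zero_or_pos j' with rfl | hj0
        · simp only [List.getD_cons_zero]
          intro hue
          have huv : u ≠ v := by
            rintro rfl
            exact hn _ (getD_mem_of_lt (by simpa using hi)) hu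
          have := hf (mem_sdiff.2 ⟨hue, by simpa using huv⟩)
          have h2 := hun 0 hi0
          simp only [List.getD_cons_zero] at h2
          exact h2 this
        · obtain ⟨j', rfl⟩ : ∃ i', j' = i' + 1 := ⟨j' - 1, by omega⟩
          rw [List.getD_cons_succ]
          exact hun j' (by omega)
      · rwa [List.getD_cons_succ]

theorem reorder [DecidableEq α] {k : ℕ} (es : List (Finset α)) (hes : ValidOrdering k es) :
    ∀ e ∈ es, ∃ l, (e :: l).Perm es ∧ ValidOrdering k (e :: l) := by
  induction es using List.reverseRecOn with
  | nil => simp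
  | append_singleton l e ih =>
    by_cases hl : l = []
    · subst hl
      intro f hf
      have : f = e := by simpa using hf
      subst this
      exact ⟨[], by simp, by simpa using hes⟩
    obtain ⟨h1, h2, v, hv, hvn, f, hf, hfs⟩ := valid_of_append hes hl
    intro g hg
    rcases List.mem_append.1 hg with hg | hg
    · obtain ⟨l', hp, hv'⟩ := ih h1 g hg
      refine ⟨l' ++ [e], ?_, ?_⟩
      · exact List.Perm.append_right [e] hp
      · refine valid_append (l := g :: l') hv' h2 hv ?_ ⟨f, hp.mem_iff.2 hf, hfs⟩
        intro f' hf'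
        exact hvn f' (hp.mem_iff.1 hf')
    · have : g = e := by simpa using hg
      subst this
      obtain ⟨l', hp, hv'⟩ := ih h1 f hf
      refine ⟨f :: l', ?_, valid_cons hv' h2 hv ?_ hfs⟩
      · exact (List.Perm.cons g hp).trans (List.perm_append_singleton g l).symm
      · intro f' hf'
        exact hvn f' (hp.mem_iff.1 hf')

theorem tight_insert [DecidableEq α] {k : ℕ} {T : Finset (Finset α)} {e : Finset α} {v : α}
    (hT : IsTightTree k T) (he : e.card = k) (hv : v ∈ e) (hn : ∀ f ∈ T, v ∉ f)
    (hf : ∃ f ∈ T, e \ {v} ⊆ f) : IsTightTree k (insert e T) := by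
  obtain ⟨es, h1, h2, rfl, h4⟩ := hT
  refine ⟨es ++ [e], by simp, ?_, ?_, valid_append h4 he hv (by simpa using hn) (by simpa using hf)⟩
  · rw [List.nodup_append]
    refine ⟨h2, by simp, ?_⟩
    intro a ha b hb
    have : b = e := by simpa using hb
    subst this
    rintro rfl
    exact hn a (by simpa using ha) hv
  · ext x; simp

theorem tight_singleton [DecidableEq α] {k : ℕ} {e : Finset α} (he : e.card = k) :
    IsTightTree k {e} := by
  refine ⟨[e], by simp, by simp, by simp, by simp [he], ?_⟩
  intro i h0 hi
  simp at hi; omega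

theorem tight_of_index [DecidableEq α] {k : ℕ} (E : ℕ → Finset α) (v : ℕ → α) (p : ℕ → ℕ)
    (S : Finset ℕ) (z : ℕ) (hz : z ∈ S) (hmin : ∀ i ∈ S, z ≤ i)
    (hcard : ∀ i ∈ S, (E i).card = k)
    (hpar : ∀ i ∈ S, i ≠ z → p i ∈ S ∧ p i < i ∧ v i ∈ E i ∧ (∀ j ∈ S, j < i → v i ∉ E j) ∧
      E i \ {v i} ⊆ E (p i)) : IsTightTree k (S.image E) := by
  have key : ∀ n, z ≤ n → IsTightTree k ((S.filter (fun i => i ≤ n)).image E) := by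
    intro n hn
    induction n, hn using Nat.le_induction with
    | base =>
      have : S.filter (fun i => i ≤ z) = {z} := by
        ext i
        rw [mem_filter, mem_singleton]
        constructor
        · rintro ⟨h1, h2⟩; exact le_antisymm h2 (hmin i h1)
        · rintro rfl; exact ⟨hz, le_rfl⟩
      rw [this, image_singleton]
      exact tight_singleton (hcard z hz)
    | succ n hn ih =>
      by_cases hS : n + 1 ∈ S
      · have : S.filter (fun i => i ≤ n + 1) = insert (n + 1) (S.filter (fun i => i ≤ n)) := by
          ext i
          rw [mem_insert, mem_filter, mem_filter]
          constructor
          · rintro ⟨h1, h2⟩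
            by_cases h : i = n + 1
            · exact Or.inl h
            · exact Or.inr ⟨h1, by omega⟩
          · rintro (rfl | ⟨h1, h2⟩)
            · exact ⟨hS, le_rfl⟩
            · exact ⟨h1, by omega⟩
        rw [this, image_insert]
        obtain ⟨h1, h2, h3, h4, h5⟩ := hpar (n + 1) hS (by omega)
        refine tight_insert ih (hcard _ hS) h3 ?_ ⟨E (p (n + 1)), ?_, h5⟩
        · intro f hf
          obtain ⟨j, hj, rfl⟩ := mem_image.1 hf
          rw [mem_filter] at hj
          exact h4 j hj.1 (by omega)
        · exact mem_image_of_mem _ (mem_filter.2 ⟨h1, by omega⟩)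
      · have : S.filter (fun i => i ≤ n + 1) = S.filter (fun i => i ≤ n) := by
          ext i
          rw [mem_filter, mem_filter]
          constructor
          · rintro ⟨h1, h2⟩
            refine ⟨h1, ?_⟩
            by_contra h
            have : i = n + 1 := by omega
            subst this; exact hS h1
          · rintro ⟨h1, h2⟩
            exact ⟨h1, by omega⟩
        rw [this]; exact ih
  have h := key (S.sup id) (le_sup (f := id) hz)
  have h2 : S.filter (fun i => i ≤ S.sup id) = S :=
    filter_true_of_mem (fun i hi => le_sup (f := id) hi)
  rwa [h2] at h

end Trees

/-- Combinatorial data extracted from a layered tight tree: edges `E 0, …, E (t-1)` in a valid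
order, new vertices `v`, layer function `lay`, window starts `w` and parents `p`. -/
structure Geo [DecidableEq α] (k Δ t : ℕ) (E : ℕ → Finset α) (v : ℕ → α) (lay : α → ℕ)
    (w p : ℕ → ℕ) : Prop where
  hk : 2 ≤ k
  ht : 0 < t
  lay_lo : ∀ i, i < t → ∀ u ∈ E i, w i ≤ lay u
  lay_hi : ∀ i, i < t → ∀ u ∈ E i, lay u < w i + k
  lay_inj : ∀ i, i < t → ∀ u ∈ E i, ∀ u' ∈ E i, lay u = lay u' → u = u'
  lay_surj : ∀ i, i < t → ∀ n, w i ≤ n → n < w i + k → ∃ u ∈ E i, lay u = n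
  w0 : w 0 = 1
  p_lt : ∀ i, 0 < i → p i < i
  v_mem : ∀ i, 0 < i → i < t → v i ∈ E i
  v_new : ∀ i, 0 < i → i < t → ∀ j, j < i → v i ∉ E j
  p_sub : ∀ i, 0 < i → i < t → E i \ {v i} ⊆ E (p i)
  v_not_min : ∀ i, 0 < i → i < t → lay (v i) ≠ w i
  p_w : ∀ i, 0 < i → i < t → w (p i) = w i ∨ (w (p i) + 1 = w i ∧ lay (v i) + 1 = w i + k ∧
    ∀ j, j < i → E i \ {v i} ⊆ E j → w j ≠ w i)
  deg : ∀ u, ((range t).filter (fun i => u ∈ E i)).card ≤ Δ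

/-- The indices at which we are allowed to cut. -/
noncomputable def cuts (d t : ℕ) (w p : ℕ → ℕ) : Finset ℕ :=
  (range t).filter (fun i => 0 < i ∧ w (p i) + 1 = w i ∧ d ∣ w i - 1)

theorem mem_cuts {d t : ℕ} {w p : ℕ → ℕ} {i : ℕ} :
    i ∈ cuts d t w p ↔ i < t ∧ 0 < i ∧ w (p i) + 1 = w i ∧ d ∣ w i - 1 := by
  rw [cuts, mem_filter, mem_range]

theorem geom_bound {Δ : ℕ} (hΔ : 2 ≤ Δ) (d : ℕ) :
    ∑ l ∈ range d, Δ ^ (l + 1) ≤ 2 * Δ ^ d := by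
  induction d with
  | zero => simp
  | succ d ih =>
    rw [sum_range_succ]
    have : 2 * Δ ^ d ≤ Δ ^ (d + 1) := by
      rw [pow_succ, mul_comm]; exact Nat.mul_le_mul_left _ hΔ
    omega

namespace Geo

variable [DecidableEq α] {k Δ t : ℕ} {E : ℕ → Finset α} {v : ℕ → α} {lay : α → ℕ}
  {w p : ℕ → ℕ}

theorem w_pos (G : Geo k Δ t E v lay w p) (i : ℕ) (hi : i < t) : 1 ≤ w i := by
  induction i using Nat.strong_induction_on with
  | _ i ih =>
    rcases Nat.eq_zero_or_pos i with rfl | h0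
    · exact G.w0.ge
    · have h1 := ih (p i) (G.p_lt i h0) ((G.p_lt i h0).trans hi)
      rcases G.p_w i h0 hi with h | h <;> omega

theorem w_mono (G : Geo k Δ t E v lay w p) (i : ℕ) (hi0 : 0 < i) (hi : i < t) : w (p i) ≤ w i := by
  rcases G.p_w i hi0 hi with h | h <;> omega

theorem w_le_of_rho (G : Geo k Δ t E v lay w p) {R : Finset ℕ} (i : ℕ) (hi : i < t) : w (rho p R i) ≤ w i := by
  induction i using Nat.strong_induction_on with
  | _ i ih =>
    rcases Nat.eq_zero_or_pos i with rfl | h0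
    · rw [rho_zero]
    · by_cases h : i ∈ R
      · rw [rho_of_mem h]
      · rw [rho_step G.p_lt h0 h]
        have := ih (p i) (G.p_lt i h0) ((G.p_lt i h0).trans hi)
        exact this.trans (G.w_mono i h0 hi)

/-- the minimal-layer vertex of an edge lies in its parent edge -/
theorem min_mem (G : Geo k Δ t E v lay w p) (i : ℕ) (h0 : 0 < i) (hi : i < t) : ∃ u ∈ E i, u ∈ E (p i) ∧ lay u = w i := by
  obtain ⟨u, hu, hl⟩ := G.lay_surj i hi (w i) le_rfl (by have := G.hk; omega)
  refine ⟨u, hu, G.p_sub i h0 hi (mem_sdiff.2 ⟨hu, ?_⟩), hl⟩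
  rw [mem_singleton]
  rintro rfl
  exact G.v_not_min i h0 hi hl

theorem cut_dvd (G : Geo k Δ t E v lay w p) {d x : ℕ} (hx : x ∈ cuts d t w p ∨ x = 0) : d ∣ w x - 1 := by
  rcases hx with h | rfl
  · exact (mem_cuts.1 h).2.2.2
  · rw [G.w0]; simp

theorem block_w (G : Geo k Δ t E v lay w p) {d x : ℕ} (hd : 1 ≤ d) (hx : x ∈ cuts d t w p ∨ x = 0) (i : ℕ) (hi : i < t)
    (h : rho p (cuts d t w p) i = x) : w x ≤ w i ∧ w i < w x + d := by
  induction i using Nat.strong_induction_on with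
  | _ i ih =>
    by_cases hix : i = x
    · subst hix; omega
    rcases Nat.eq_zero_or_pos i with rfl | h0
    · rw [rho_zero] at h; exact absurd h hix
    by_cases hC : i ∈ cuts d t w p
    · rw [rho_of_mem hC] at h; exact absurd h hix
    have hpt := (G.p_lt i h0).trans hi
    rw [rho_step G.p_lt h0 hC] at h
    have h1 := ih (p i) (G.p_lt i h0) hpt h
    rcases G.p_w i h0 hi with h2 | ⟨h2, -⟩
    · omega
    · refine ⟨by omega, ?_⟩
      by_contra hcon
      apply hC
      rw [mem_cuts]
      refine ⟨hi, h0, h2, ?_⟩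
      have hxt : x < t := by
        rcases hx with hx | rfl
        · exact (mem_cuts.1 hx).1
        · exact G.ht
      have := G.w_pos x hxt
      have h3 : w i - 1 = (w x - 1) + d := by omega
      rw [h3]
      exact (G.cut_dvd hx).add (dvd_refl d)

/-- level `l` of the block of `x` -/
theorem level_card (G : Geo k Δ t E v lay w p) {d x : ℕ} (hd : 1 ≤ d) (hx : x ∈ cuts d t w p ∨ x = 0) (l : ℕ) :
    ((range t).filter (fun i => rho p (cuts d t w p) i = x ∧ w i = w x + l)).card
      ≤ Δ ^ (l + 1) := by
  have hxt : x < t := by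
    rcases hx with hx | rfl
    · exact (mem_cuts.1 hx).1
    · exact G.ht
  have hk := G.hk
  induction l with
  | zero =>
    obtain ⟨u, hu, hul⟩ := G.lay_surj x hxt (w x) le_rfl (by omega)
    have key : ∀ i, i < t → rho p (cuts d t w p) i = x → w i = w x → u ∈ E i := by
      intro i
      induction i using Nat.strong_induction_on with
      | _ i ih =>
        intro hi h hw
        by_cases hix : i = x
        · subst hix; exact hu
        rcases Nat.eq_zero_or_pos i with rfl | h0
        · rw [rho_zero] at h; exact absurd h hix
        by_cases hC : i ∈ cuts d t w p
        · rw [rho_of_mem hC] at h; exact absurd h hix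
        have hpt := (G.p_lt i h0).trans hi
        rw [rho_step G.p_lt h0 hC] at h
        have h1 := G.block_w hd hx (p i) hpt h
        have h2 := G.w_mono i h0 hi
        have h3 := ih (p i) (G.p_lt i h0) hpt h (by omega)
        obtain ⟨u', hu', hup, hl⟩ := G.min_mem i h0 hi
        have := G.lay_inj (p i) hpt u h3 u' hup (by omega)
        rw [this]; exact hu'
    refine le_trans (card_le_card ?_) ((G.deg u).trans (by simp))
    intro i hi
    rw [mem_filter, mem_range] at hi ⊢
    exact ⟨hi.1, key i hi.1 hi.2.1 (by omega)⟩
  | succ l ih =>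
    have hch : ∀ j, ∃ u, j < t → u ∈ E j ∧ lay u = w j + 1 := by
      intro j
      by_cases hj : j < t
      · obtain ⟨u, hu, hul⟩ := G.lay_surj j hj (w j + 1) (by omega) (by omega)
        exact ⟨u, fun _ => ⟨hu, hul⟩⟩
      · obtain ⟨u, hu, hul⟩ := G.lay_surj x hxt (w x) le_rfl (by omega)
        exact ⟨u, fun h => absurd h hj⟩
    choose f hf using hch
    have key : ∀ i, i < t → rho p (cuts d t w p) i = x → w i = w x + (l + 1) →
        ∃ j, j < t ∧ rho p (cuts d t w p) j = x ∧ w j = w x + l ∧ f j ∈ E i := by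
      intro i
      induction i using Nat.strong_induction_on with
      | _ i ih =>
        intro hi h hw
        by_cases hix : i = x
        · subst hix; omega
        rcases Nat.eq_zero_or_pos i with rfl | h0
        · rw [rho_zero] at h; exact absurd h hix
        by_cases hC : i ∈ cuts d t w p
        · rw [rho_of_mem hC] at h; exact absurd h hix
        have hpt := (G.p_lt i h0).trans hi
        rw [rho_step G.p_lt h0 hC] at h
        obtain ⟨u', hu', hup, hl⟩ := G.min_mem i h0 hi
        rcases G.p_w i h0 hi with h2 | ⟨h2, -⟩
        · obtain ⟨j, hj, hjr, hjw, hjf⟩ := ih (p i) (G.p_lt i h0) hpt h (by omega)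
          refine ⟨j, hj, hjr, hjw, ?_⟩
          have := G.lay_inj (p i) hpt (f j) hjf u' hup (by rw [(hf j hj).2]; omega)
          rw [this]; exact hu'
        · refine ⟨p i, hpt, h, by omega, ?_⟩
          have := G.lay_inj (p i) hpt (f (p i)) (hf _ hpt).1 u' hup
            (by rw [(hf _ hpt).2]; omega)
          rw [this]; exact hu'
    set A := (range t).filter (fun i => rho p (cuts d t w p) i = x ∧ w i = w x + l) with hA
    have hsub : (range t).filter (fun i => rho p (cuts d t w p) i = x ∧ w i = w x + (l + 1)) ⊆
        A.biUnion (fun j => (range t).filter (fun i => f j ∈ E i)) := by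
      intro i hi
      rw [mem_filter, mem_range] at hi
      obtain ⟨j, hj, hjr, hjw, hjf⟩ := key i hi.1 hi.2.1 hi.2.2
      rw [mem_biUnion]
      refine ⟨j, ?_, ?_⟩
      · rw [hA, mem_filter, mem_range]; exact ⟨hj, hjr, hjw⟩
      · rw [mem_filter, mem_range]; exact ⟨hi.1, hjf⟩
    refine (card_le_card hsub).trans ((card_biUnion_le_card_mul A _ Δ (fun j _ => G.deg _)).trans ?_)
    rw [pow_succ Δ (l + 1)]
    exact Nat.mul_le_mul_right _ ih

theorem block_card (G : Geo k Δ t E v lay w p) {d x : ℕ} (hΔ : 2 ≤ Δ) (hd : 1 ≤ d) (hx : x ∈ cuts d t w p ∨ x = 0) :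
    ((range t).filter (fun i => rho p (cuts d t w p) i = x)).card ≤ 2 * Δ ^ d := by
  have hsub : (range t).filter (fun i => rho p (cuts d t w p) i = x) ⊆
      (range d).biUnion (fun l =>
        (range t).filter (fun i => rho p (cuts d t w p) i = x ∧ w i = w x + l)) := by
    intro i hi
    rw [mem_filter, mem_range] at hi
    have := G.block_w hd hx i hi.1 hi.2
    rw [mem_biUnion]
    refine ⟨w i - w x, by rw [mem_range]; omega, ?_⟩
    rw [mem_filter, mem_range]
    exact ⟨hi.1, hi.2, by omega⟩
  refine (card_le_card hsub).trans (card_biUnion_le.trans ?_)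
  exact (sum_le_sum (fun l _ => G.level_card hd hx l)).trans (geom_bound hΔ d)

theorem cut_sub (G : Geo k Δ t E v lay w p) {c c' : ℕ} (hc0 : 0 < c) (hct : c < t) (hcw : w (p c) + 1 = w c)
    (hc0' : 0 < c') (hct' : c' < t) (hcw' : w (p c') + 1 = w c') (hpp : p c = p c') :
    ¬ c < c' := by
  intro hlt
  have hk := G.hk
  obtain ⟨h1, h2⟩ : lay (v c) + 1 = w c + k ∧ True := by
    rcases G.p_w c hc0 hct with h | ⟨_, h, _⟩
    · omega
    · exact ⟨h, trivial⟩
  obtain ⟨h3, h4⟩ : lay (v c') + 1 = w c' + k ∧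
      ∀ j, j < c' → E c' \ {v c'} ⊆ E j → w j ≠ w c' := by
    rcases G.p_w c' hc0' hct' with h | ⟨_, h, h'⟩
    · omega
    · exact ⟨h, h'⟩
  have hww : w c = w c' := by rw [← hcw, ← hcw', hpp]
  refine h4 c hlt ?_ hww
  intro u hu
  have hup := G.p_sub c' hc0' hct' hu
  rw [mem_sdiff, mem_singleton] at hu
  have hlo := G.lay_lo c' hct' u hu.1
  have hhi := G.lay_hi c' hct' u hu.1
  have hne : lay u ≠ lay (v c') := fun h =>
    hu.2 (G.lay_inj c' hct' u hu.1 _ (G.v_mem c' hc0' hct') h)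
  obtain ⟨u2, hu2, hl2⟩ := G.lay_surj c hct (lay u) (by omega) (by omega)
  have hu2v : u2 ≠ v c := by rintro rfl; omega
  have hu2p := G.p_sub c hc0 hct (mem_sdiff.2 ⟨hu2, by simpa using hu2v⟩)
  rw [hpp] at hu2p
  have := G.lay_inj (p c') ((G.p_lt c' hc0').trans hct') u2 hu2p u hup hl2
  rw [← this]; exact hu2

theorem child_card (G : Geo k Δ t E v lay w p) {d x : ℕ} (hd : 1 ≤ d) (hx : x ∈ cuts d t w p ∨ x = 0) :
    ((cuts d t w p).filter (fun c => rho p (cuts d t w p) (p c) = x)).card ≤ Δ ^ d := by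
  have hxt : x < t := by
    rcases hx with hx | rfl
    · exact (mem_cuts.1 hx).1
    · exact G.ht
  have h := G.level_card hd hx (d - 1)
  rw [Nat.sub_add_cancel hd] at h
  refine le_trans (card_le_card_of_injOn p ?_ ?_) h
  · intro c hc
    rw [mem_coe, mem_filter, mem_cuts] at hc
    obtain ⟨⟨hct, hc0, hcw, hcd⟩, hr⟩ := hc
    have hpt := (G.p_lt c hc0).trans hct
    rw [mem_coe, mem_filter, mem_range]
    refine ⟨hpt, hr, ?_⟩
    have h1 := G.block_w hd hx (p c) hpt hr
    have h2 := G.w_pos x hxt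
    obtain ⟨a, ha⟩ := G.cut_dvd hx
    obtain ⟨b, hb⟩ := hcd
    have h3 : d * a < d * b := by omega
    have h4 : d * b ≤ d * a + d := by omega
    have h5 : a < b := Nat.lt_of_mul_lt_mul_left h3
    have h6 : d * (a + 1) ≤ d * b := Nat.mul_le_mul_left d h5
    rw [Nat.mul_add, Nat.mul_one] at h6
    omega
  · intro c hc c' hc' hpp
    rw [mem_coe, mem_filter, mem_cuts] at hc hc'
    obtain ⟨⟨hct, hc0, hcw, hcd⟩, hr⟩ := hc
    obtain ⟨⟨hct', hc0', hcw', hcd'⟩, hr'⟩ := hc'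
    have h1 := G.cut_sub hc0 hct hcw hc0' hct' hcw' hpp
    have h2 := G.cut_sub hc0' hct' hcw' hc0 hct hcw hpp.symm
    omega

/-- The edges containing a given vertex form a connected set with respect to parents. -/
theorem vertex_root (G : Geo k Δ t E v lay w p) {R : Finset ℕ} {u : α} {z : ℕ} (i : ℕ) (hi : i < t) (hu : u ∈ E i)
    (hr : rho p R i = z) (hz : z = 0 ∨ u ∉ E z \ {v z}) :
    z = 0 ∨ ∃ j, j < t ∧ u ∈ E j ∧ rho p R j = z ∧ ∀ j', j' < j → u ∉ E j' := by
  induction i using Nat.strong_induction_on with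
  | _ i ih =>
    rcases Nat.eq_zero_or_pos i with rfl | h0
    · rw [rho_zero] at hr; exact Or.inl hr.symm
    by_cases huv : u = v i
    · subst huv
      exact Or.inr ⟨i, hi, hu, hr, G.v_new i h0 hi⟩
    have hmem : u ∈ E i \ {v i} := mem_sdiff.2 ⟨hu, by simpa using huv⟩
    by_cases hR : i ∈ R
    · rw [rho_of_mem hR] at hr
      subst hr
      rcases hz with hz | hz
      · exact Or.inl hz
      · exact absurd hmem hz
    · rw [rho_step G.p_lt h0 hR] at hr
      exact ih (p i) (G.p_lt i h0) ((G.p_lt i h0).trans hi) (G.p_sub i h0 hi hmem) hr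

/-- If `u` first appears at index `j`, then every edge containing `u` has root at least
the root of `j`. -/
theorem root_le (G : Geo k Δ t E v lay w p) {R : Finset ℕ} {u : α} {j : ℕ} (huj : u ∈ E j) (hj : ∀ j', j' < j → u ∉ E j') (i : ℕ)
    (hi : i < t) (hu : u ∈ E i) : rho p R j ≤ rho p R i := by
  induction i using Nat.strong_induction_on with
  | _ i ih =>
    by_cases hij : i = j
    · subst hij; exact le_rfl
    have hji : j < i := by
      by_contra h; exact hj i (by omega) hu
    have h0 : 0 < i := by omega
    by_cases hR : i ∈ R
    · rw [rho_of_mem hR]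
      exact (rho_le G.p_lt R j).trans hji.le
    by_cases huv : u = v i
    · subst huv
      exact absurd huj (G.v_new i h0 hi j hji)
    · rw [rho_step G.p_lt h0 hR]
      exact ih (p i) (G.p_lt i h0) ((G.p_lt i h0).trans hi)
        (G.p_sub i h0 hi (mem_sdiff.2 ⟨hu, by simpa using huv⟩))

end Geo

theorem mem_hverts [DecidableEq α] {T : Finset (Finset α)} {u : α} :
    u ∈ hverts T ↔ ∃ e ∈ T, u ∈ e := by
  rw [hverts, mem_sup]; simp

theorem geo_exists [DecidableEq α] (k Δ : ℕ) (hk : 2 ≤ k)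
    (T : Finset (Finset α)) (hT : IsTightTree k T)
    (r : Finset α) (hr : InShadow k T r)
    (mL : ℕ) (L : ℕ → Finset α) (hL : IsLayering k T r mL L)
    (hdeg : ∀ v, vdeg T v ≤ Δ) :
    ∃ (E : ℕ → Finset α) (v : ℕ → α) (lay : α → ℕ) (w p : ℕ → ℕ),
      Geo k Δ T.card E v lay w p ∧ r ⊆ E 0 ∧ (range T.card).image E = T ∧
      Set.InjOn E (range T.card : Finset ℕ) ∧ (∀ e ∈ T, e.card = k) ∧
      (∀ i, i < T.card → ∀ n, w i ≤ n → n < w i + k → (E i ∩ L n).card = 1) ∧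
      (∀ i, i < T.card → ∀ u ∈ E i, ∀ n, w i ≤ n → n < w i + k → u ∈ L n → lay u = n) := by
  obtain ⟨es, hne, hnd, hTes, hval⟩ := hT
  obtain ⟨hrc, e0, he0, hre0⟩ := hr
  have he0' : e0 ∈ es := by rw [← hTes] at he0; simpa using he0
  obtain ⟨l, hperm, hlv⟩ := reorder es hval e0 he0'
  set l' := e0 :: l with hl'
  have hl'nd : l'.Nodup := hperm.nodup_iff.2 hnd
  have hl'T : l'.toFinset = T := by rw [← hTes]; exact List.toFinset_eq_of_perm _ _ hperm
  have hlen : T.card = l'.length := by rw [← hl'T]; exact List.toFinset_card_of_nodup hl'nd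
  have hmemT : ∀ e, e ∈ T ↔ e ∈ l' := by intro e; rw [← hl'T]; simp
  set t := T.card with ht
  have ht0 : 0 < t := card_pos.2 ⟨e0, he0⟩
  obtain ⟨E, hE⟩ : ∃ E : ℕ → Finset α, ∀ i, E i = l'.getD i ∅ := ⟨_, fun _ => rfl⟩
  have hET : ∀ i, i < t → E i ∈ T := by
    intro i hi
    rw [hE, hmemT]; exact getD_mem_of_lt (by omega)
  have hcard : ∀ e ∈ T, e.card = k := fun e he => hlv.1 e ((hmemT e).1 he)
  have himg : (range t).image E = T := by
    ext e
    rw [mem_image]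
    constructor
    · rintro ⟨i, hi, rfl⟩; exact hET i (mem_range.1 hi)
    · intro he
      obtain ⟨j, hj, hje⟩ := exists_getD_of_mem ((hmemT e).1 he)
      exact ⟨j, mem_range.2 (by omega), by rw [hE, hje]⟩
  have hinj : Set.InjOn E (range t : Finset ℕ) := by
    apply card_image_iff.1
    rw [himg, card_range]
  have hE0 : E 0 = e0 := by rw [hE, hl']; simp
  -- layers
  obtain ⟨lay, hlay⟩ : ∃ lay : α → ℕ, ∀ u n, 1 ≤ n → n ≤ mL → u ∈ L n → lay u = n := by
    refine ⟨fun u => if h : ∃ n, 1 ≤ n ∧ n ≤ mL ∧ u ∈ L n then h.choose else 0, ?_⟩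
    intro u n h1 h2 h3
    have h : ∃ n, 1 ≤ n ∧ n ≤ mL ∧ u ∈ L n := ⟨n, h1, h2, h3⟩
    simp only [dif_pos h]
    obtain ⟨a1, a2, a3⟩ := h.choose_spec
    by_contra hne
    exact (disjoint_left.1 (hL.layer_disjoint _ _ a1 a2 h1 h2 hne)) a3 h3
  have hW : ∀ i, ∃ j, i < t → 1 ≤ j ∧ j + (k - 1) ≤ mL ∧
      ∀ n, j ≤ n → n < j + k → (E i ∩ L n).card = 1 := by
    intro i
    by_cases hi : i < t
    · obtain ⟨j, hj⟩ := hL.window (E i) (hET i hi)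
      exact ⟨j, fun _ => hj⟩
    · exact ⟨0, fun h => absurd h hi⟩
  choose w hw using hW
  have hsurj : ∀ i, i < t → ∀ n, w i ≤ n → n < w i + k → ∃ u ∈ E i, lay u = n := by
    intro i hi n h1 h2
    obtain ⟨a1, a2, a3⟩ := hw i hi
    obtain ⟨u, hu⟩ := card_eq_one.1 (a3 n h1 h2)
    have hu' : u ∈ E i ∩ L n := by rw [hu]; simp
    rw [mem_inter] at hu'
    exact ⟨u, hu'.1, hlay u n (by omega) (by omega) hu'.2⟩
  have hlayimg : ∀ i, i < t → Ico (w i) (w i + k) = (E i).image lay := by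
    intro i hi
    apply eq_of_subset_of_card_le
    · intro n hn
      rw [mem_Ico] at hn
      obtain ⟨u, hu, hul⟩ := hsurj i hi n hn.1 hn.2
      exact mem_image.2 ⟨u, hu, hul⟩
    · refine card_image_le.trans ?_
      rw [hcard _ (hET i hi)]; simp
  have hlo : ∀ i, i < t → ∀ u ∈ E i, w i ≤ lay u ∧ lay u < w i + k := by
    intro i hi u hu
    have : lay u ∈ Ico (w i) (w i + k) := by
      rw [hlayimg i hi]; exact mem_image_of_mem _ hu
    exact mem_Ico.1 this
  have hlinj : ∀ i, i < t → ∀ u ∈ E i, ∀ u' ∈ E i, lay u = lay u' → u = u' := by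
    intro i hi u hu u' hu' h
    have : Set.InjOn lay (E i) := by
      apply card_image_iff.1
      rw [← hlayimg i hi, hcard _ (hET i hi)]; simp
    exact this hu hu' h
  have hlayL : ∀ i, i < t → ∀ u ∈ E i, 1 ≤ lay u ∧ lay u ≤ mL ∧ u ∈ L (lay u) := by
    intro i hi u hu
    obtain ⟨n, h1, h2, h3⟩ := hL.cover u (mem_hverts.2 ⟨_, hET i hi, hu⟩)
    rw [hlay u n h1 h2 h3]; exact ⟨h1, h2, h3⟩
  have hmL : 1 ≤ mL := by
    have := hw 0 ht0; omega
  -- the first layer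
  obtain ⟨u0, hu0⟩ := card_eq_one.1 hL.first_card
  have hu0r : u0 ∈ r := by
    have h1 := hL.root_inter 1 le_rfl (by omega)
    obtain ⟨x, hx⟩ := card_eq_one.1 h1
    have hx' : x ∈ r ∩ L 1 := by rw [hx]; simp
    rw [mem_inter, hu0, mem_singleton] at hx'
    rw [← hx'.2]; exact hx'.1
  have hu0E : u0 ∈ E 0 := by rw [hE0]; exact hre0 hu0r
  have hw0 : w 0 = 1 := by
    have h1 := hlay u0 1 le_rfl hmL (by rw [hu0]; simp)
    have h2 := hlo 0 ht0 u0 hu0E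
    have h3 := hw 0 ht0
    omega
  -- new vertices
  have hvq : ∀ i, ∃ vq : α × ℕ, 0 < i → i < t → vq.1 ∈ E i ∧ (∀ j, j < i → vq.1 ∉ E j) ∧
      vq.2 < i ∧ E i \ {vq.1} ⊆ E vq.2 := by
    intro i
    by_cases h : 0 < i ∧ i < t
    · obtain ⟨v, hv, hvn, j, hj, hjs⟩ := hlv.2 i h.1 (by omega)
      refine ⟨(v, j), fun _ _ => ⟨?_, ?_, hj, ?_⟩⟩
      · rw [hE]; exact hv
      · intro j hj; rw [hE]; exact hvn j hj
      · rw [hE, hE]; exact hjs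
    · exact ⟨(u0, 0), fun h1 h2 => absurd ⟨h1, h2⟩ h⟩
  choose vq hvq using hvq
  obtain ⟨v, hv⟩ : ∃ v : ℕ → α, ∀ i, v i = (vq i).1 := ⟨_, fun _ => rfl⟩
  obtain ⟨q, hq⟩ : ∃ q : ℕ → ℕ, ∀ i, q i = (vq i).2 := ⟨_, fun _ => rfl⟩
  have hvm : ∀ i, 0 < i → i < t → v i ∈ E i := fun i h1 h2 => by
    rw [hv]; exact (hvq i h1 h2).1
  have hvn : ∀ i, 0 < i → i < t → ∀ j, j < i → v i ∉ E j := fun i h1 h2 => by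
    rw [hv]; exact (hvq i h1 h2).2.1
  have hql : ∀ i, 0 < i → i < t → q i < i := fun i h1 h2 => by
    rw [hq]; exact (hvq i h1 h2).2.2.1
  have hqs : ∀ i, 0 < i → i < t → E i \ {v i} ⊆ E (q i) := fun i h1 h2 => by
    rw [hv, hq]; exact (hvq i h1 h2).2.2.2
  -- no new vertex lies in the lowest layer of its edge
  have hnomin : ∀ n i, w i = n → 0 < i → i < t → lay (v i) ≠ w i := by
    intro n
    induction n using Nat.strong_induction_on with
    | _ n ih =>
      intro i hwi hi0 hit hcon
      have hvi := hvm i hi0 hit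
      obtain ⟨a1, a2, a3⟩ := hlayL i hit _ hvi
      by_cases h1 : w i = 1
      · have : v i ∈ L 1 := by rw [hcon, h1] at a3; exact a3
        rw [hu0, mem_singleton] at this
        exact hvn i hi0 hit 0 hi0 (by rw [this]; exact hu0E)
      have hw2 : 2 ≤ w i := by omega
      have hex : ∃ j, j < t ∧ v i ∈ E j ∧ ∃ u ∈ E j, lay u + 1 = w i := by
        obtain ⟨u, huL, e, he, hve, hue⟩ := hL.link (w i - 1) (by omega) (by omega) (v i)
          (by rw [Nat.sub_add_cancel (by omega), ← hcon]; exact a3)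
        rw [← himg] at he
        obtain ⟨j, hj, rfl⟩ := mem_image.1 he
        refine ⟨j, mem_range.1 hj, hve, u, hue, ?_⟩
        rw [hlay u (w i - 1) (by omega) (by omega) huL]; omega
      set j := Nat.find hex with hj
      obtain ⟨hjt, hvj, u, huj, hul⟩ := Nat.find_spec hex
      have hmin : ∀ j', j' < j → ¬ (j' < t ∧ v i ∈ E j' ∧ ∃ u ∈ E j', lay u + 1 = w i) :=
        fun j' h => Nat.find_min hex h
      rw [← hj] at hjt hvj huj
      have hji : i < j := by
        rcases lt_trichotomy i j with h | h | h
        · exact h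
        · rw [← h] at huj
          have := hlo i hit u huj
          omega
        · exact absurd hvj (hvn i hi0 hit j h)
      have hj0 : 0 < j := by omega
      have hqj := hql j hj0 hjt
      have hqt := hqj.trans hjt
      have hvne : v i ≠ v j := by
        intro h
        exact hvn j hj0 hjt i hji (by rw [← h]; exact hvi)
      have hviq : v i ∈ E (q j) := hqs j hj0 hjt (mem_sdiff.2 ⟨hvj, by simpa using hvne⟩)
      have huv : u = v j := by
        by_contra hne
        exact hmin (q j) hqj ⟨hqt, hviq, u,
          hqs j hj0 hjt (mem_sdiff.2 ⟨huj, by simpa using hne⟩), hul⟩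
      have hwj := hlo j hjt u huj
      have hwj2 : w j + 1 = w i := by
        by_contra hne
        obtain ⟨u2, hu2, hl2⟩ := hsurj j hjt (w j) le_rfl (by omega)
        have hu2v : u2 ≠ v j := by
          intro h; rw [h, ← huv] at hl2; omega
        have hu2q := hqs j hj0 hjt (mem_sdiff.2 ⟨hu2, by simpa using hu2v⟩)
        have b1 := hlo (q j) hqt u2 hu2q
        have b2 := hlo (q j) hqt _ hviq
        obtain ⟨u3, hu3, hl3⟩ := hsurj (q j) hqt (w i - 1) (by omega) (by omega)
        exact hmin (q j) hqj ⟨hqt, hviq, u3, hu3, by omega⟩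
      exact ih (w j) (by omega) j rfl hj0 hjt (by rw [← huv]; omega)
  -- canonical parents
  have hpar : ∀ i, ∃ p, (0 < i → p < i) ∧ (0 < i → i < t → E i \ {v i} ⊆ E p ∧
      (w p = w i ∨ (w p + 1 = w i ∧ lay (v i) + 1 = w i + k ∧
        ∀ j, j < i → E i \ {v i} ⊆ E j → w j ≠ w i))) := by
    intro i
    by_cases h : 0 < i ∧ i < t
    · obtain ⟨hi0, hit⟩ := h
      by_cases hsame : ∃ j, j < i ∧ E i \ {v i} ⊆ E j ∧ w j = w i
      · obtain ⟨j, h1, h2, h3⟩ := hsame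
        exact ⟨j, fun _ => h1, fun _ _ => ⟨h2, Or.inl h3⟩⟩
      · push Not at hsame
        have hqi := hql i hi0 hit
        have hqt := hqi.trans hit
        have hqsub := hqs i hi0 hit
        have hmem : ∀ n, w i ≤ n → n < w i + k → n ≠ lay (v i) →
            w (q i) ≤ n ∧ n < w (q i) + k := by
          intro n h1 h2 h3
          obtain ⟨u, hu, hul⟩ := hsurj i hit n h1 h2
          have huv : u ≠ v i := by rintro rfl; exact h3 hul.symm
          have := hlo (q i) hqt u (hqsub (mem_sdiff.2 ⟨hu, by simpa using huv⟩))
          omega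
        have hne := hsame (q i) hqi hqsub
        have hnm := hnomin (w i) i rfl hi0 hit
        have b0 := hlo i hit _ (hvm i hi0 hit)
        have b1 := hmem (w i) le_rfl (by omega) (fun h => hnm h.symm)
        have hmax : lay (v i) + 1 = w i + k := by
          by_contra hc
          have := hmem (w i + k - 1) (by omega) (by omega) (by omega)
          omega
        have b2 := hmem (w i + k - 2) (by omega) (by omega) (by omega)
        exact ⟨q i, fun _ => hqi, fun _ _ => ⟨hqsub, Or.inr ⟨by omega, hmax, hsame⟩⟩⟩
    · exact ⟨0, fun h => h, fun h1 h2 => absurd ⟨h1, h2⟩ h⟩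
  choose p hp1 hp2 using hpar
  refine ⟨E, v, lay, w, p, ?_, by rw [hE0]; exact hre0, himg, hinj, hcard,
    fun i hi => (hw i hi).2.2, ?_⟩
  · exact
    { hk := hk
      ht := ht0
      lay_lo := fun i hi u hu => (hlo i hi u hu).1
      lay_hi := fun i hi u hu => (hlo i hi u hu).2
      lay_inj := hlinj
      lay_surj := hsurj
      w0 := hw0
      p_lt := hp1
      v_mem := hvm
      v_new := hvn
      p_sub := fun i h1 h2 => (hp2 i h1 h2).1
      v_not_min := fun i h1 h2 => hnomin (w i) i rfl h1 h2
      p_w := fun i h1 h2 => (hp2 i h1 h2).2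
      deg := by
        intro u
        refine le_trans ?_ (hdeg u)
        refine card_le_card_of_injOn E ?_ ?_
        · intro i hi
          rw [mem_coe, mem_filter, mem_range] at hi
          rw [mem_coe, mem_filter]
          exact ⟨hET i hi.1, hi.2⟩
        · refine hinj.mono ?_
          intro i hi
          rw [mem_coe, mem_filter] at hi
          exact hi.1 }
  · intro i hi u hu n h1 h2 h3
    have := hw i hi
    exact hlay u n (by omega) (by omega) h3

theorem enum_exists (Z : Finset ℕ) (h0 : 0 ∈ Z) :
    ∃ z : ℕ → ℕ, (∀ l, 1 ≤ l → l ≤ Z.card → z l ∈ Z) ∧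
      (∀ i l, 1 ≤ i → i < l → l ≤ Z.card → z i < z l) ∧
      (∀ x ∈ Z, ∃ l, 1 ≤ l ∧ l ≤ Z.card ∧ z l = x) ∧ z 1 = 0 := by
  have hpos : 0 < Z.card := card_pos.2 ⟨0, h0⟩
  set f := Z.orderEmbOfFin rfl with hf
  obtain ⟨z, hz⟩ : ∃ z : ℕ → ℕ, ∀ l, z l = if h : l - 1 < Z.card then f ⟨l - 1, h⟩ else 0 :=
    ⟨_, fun _ => rfl⟩
  have hmono : ∀ i l, 1 ≤ i → i < l → l ≤ Z.card → z i < z l := by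
    intro i l h1 h2 h3
    rw [hz, hz, dif_pos (by omega), dif_pos (by omega)]
    apply f.strictMono
    rw [Fin.mk_lt_mk]; omega
  have hsurj : ∀ x ∈ Z, ∃ l, 1 ≤ l ∧ l ≤ Z.card ∧ z l = x := by
    intro x hx
    have : x ∈ Set.range f := by rw [hf, range_orderEmbOfFin]; exact hx
    obtain ⟨⟨i, hi⟩, rfl⟩ := this
    refine ⟨i + 1, by omega, by omega, ?_⟩
    rw [hz, dif_pos (by simpa using hi)]
    simp
  refine ⟨z, ?_, hmono, hsurj, ?_⟩
  · intro l h1 h2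
    rw [hz, dif_pos (by omega)]
    exact orderEmbOfFin_mem _ _ _
  · obtain ⟨l, h1, h2, h3⟩ := hsurj 0 h0
    by_cases h : l = 1
    · rw [← h]; exact h3
    · have := hmono 1 l le_rfl (by omega) h2
      omega

/-- Every layered tight `k`-tree `(T, r, L)` with `t ≥ 2Δ^d β⁻¹` edges and
`Δ₁(T) ≤ Δ` has a `(β, d)`-decomposition. -/
theorem decomposition_exists [DecidableEq α] (k Δ d : ℕ) (hk : 2 ≤ k) (hΔ : 2 ≤ Δ)
    (hd : 1 ≤ d) (β : ℝ) (hβ0 : 0 < β) (hβ1 : β < 1)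
    (T : Finset (Finset α)) (hT : IsTightTree k T)
    (r : Finset α) (hr : InShadow k T r)
    (mL : ℕ) (L : ℕ → Finset α) (hL : IsLayering k T r mL L)
    (hdeg : ∀ v, vdeg T v ≤ Δ)
    (hsize : 2 * (Δ : ℝ) ^ d / β ≤ (T.card : ℝ)) :
    ∃ (m : ℕ) (D : ℕ → Finset (Finset α)) (s : ℕ → Finset α),
      1 ≤ m ∧
      -- each (D i, s i) is a rooted k-subtree of T
      (∀ i, 1 ≤ i → i ≤ m → IsTightTree k (D i) ∧ D i ⊆ T ∧ InShadow k (D i) (s i)) ∧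
      -- (1) m ≤ 2Δ^d/β
      (m : ℝ) ≤ 2 * (Δ : ℝ) ^ d / β ∧
      -- (2) E(T) is the disjoint union of the E(D i)
      (∀ i j, 1 ≤ i → i < j → j ≤ m → Disjoint (D i) (D j)) ∧
      (Finset.Icc 1 m).biUnion D = T ∧
      -- (3) |E(D i)| ≤ β|E(T)|
      (∀ i, 1 ≤ i → i ≤ m → ((D i).card : ℝ) ≤ β * (T.card : ℝ)) ∧
      -- (4) s 1 = r and each s i is L-layered
      s 1 = r ∧
      (∀ i, 1 ≤ i → i ≤ m → ∃ j, LayeredRank k L (s i) j) ∧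
      -- (5) (V(D l) \ s l) ∩ V(D i) = ∅ for i < l
      (∀ i l, 1 ≤ i → i < l → l ≤ m → Disjoint (hverts (D l) \ s l) (hverts (D i))) ∧
      -- (6) each later root s l lies in the shadow of an earlier D i, with rank at least d
      -- in the layering of D i inherited from L
      (∀ l, 2 ≤ l → l ≤ m →
        ∃ i, 1 ≤ i ∧ i < l ∧ InShadow k (D i) (s l) ∧
          ∃ jl ji, LayeredRank k L (s l) jl ∧ LayeredRank k L (s i) ji ∧ ji + d ≤ jl + 1) := by
  obtain ⟨E, v, lay, w, p, G, hrE, himg, hinj, hcard, hwin, hlayL⟩ :=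
    geo_exists k Δ hk T hT r hr mL L hL hdeg
  set t := T.card with ht
  have ht0 : 0 < t := G.ht
  have htR : (0 : ℝ) < t := by exact_mod_cast ht0
  set M : ℝ := β * t with hM
  have hM0 : 0 < M := mul_pos hβ0 htR
  have hbig : 2 * (Δ : ℝ) ^ d ≤ M := by
    rw [div_le_iff₀ hβ0] at hsize
    rw [hM]; linarith
  set C := cuts d t w p with hC
  have h0C : 0 ∉ C := by
    intro h
    have := (mem_cuts.1 h).2.1
    omega
  obtain ⟨R, hRC, -, hRM, hRc⟩ := rho_partition G.p_lt C (Δ ^ d) M t hM0 h0C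
    (fun x hx => le_trans (by exact_mod_cast G.block_card hΔ hd hx) hbig)
    (fun x hx => G.child_card hd hx) t (range t) (Subset.refl _) (by simp)
    (mem_range.2 ht0) (fun i hi h0 => mem_range.2 ((G.p_lt i h0).trans (mem_range.1 hi)))
  set Z := insert 0 R with hZ
  have h0R : 0 ∉ R := fun h => h0C (hRC h)
  have hZc : Z.card = R.card + 1 := card_insert_of_notMem h0R
  have hRt : ∀ x ∈ R, x < t := fun x hx => (mem_cuts.1 (hRC hx)).1
  have hZt : ∀ x ∈ Z, x < t := by
    intro x hx
    rcases mem_insert.1 hx with rfl | h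
    · exact ht0
    · exact hRt x h
  have hZrho : ∀ x ∈ Z, rho p R x = x := by
    intro x hx
    rcases mem_insert.1 hx with rfl | h
    · exact rho_zero _
    · exact rho_of_mem h
  have hrhoZ : ∀ i, rho p R i ∈ Z := by
    intro i
    rcases rho_mem G.p_lt R i with h | h
    · exact mem_insert_of_mem h
    · rw [h]; exact mem_insert_self _ _
  obtain ⟨z, hzZ, hzmono, hzsurj, hz1⟩ := enum_exists Z (mem_insert_self _ _)
  have hzR : ∀ l, 1 ≤ l → l ≤ Z.card → z l ≠ 0 → z l ∈ R := by
    intro l h1 h2 h3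
    exact (mem_insert.1 (hzZ l h1 h2)).resolve_left h3
  obtain ⟨S, hS⟩ : ∃ S : ℕ → Finset ℕ, ∀ l i, i ∈ S l ↔ i < t ∧ rho p R i = z l :=
    ⟨fun l => (range t).filter (fun i => rho p R i = z l), fun l i => by
      rw [mem_filter, mem_range]⟩
  obtain ⟨s, hs0, hs1⟩ : ∃ s : ℕ → Finset α, (∀ l, z l = 0 → s l = r) ∧
      ∀ l, z l ≠ 0 → s l = E (z l) \ {v (z l)} :=
    ⟨fun l => if z l = 0 then r else E (z l) \ {v (z l)}, fun l h => if_pos h,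
      fun l h => if_neg h⟩
  have hET : ∀ i, i < t → E i ∈ T := by
    intro i hi
    have : E i ∈ (range t).image E := mem_image_of_mem _ (mem_range.2 hi)
    rwa [himg] at this
  have hzS : ∀ l, 1 ≤ l → l ≤ Z.card → z l ∈ S l := fun l h1 h2 =>
    (hS _ _).2 ⟨hZt _ (hzZ l h1 h2), hZrho _ (hzZ l h1 h2)⟩
  have hscard : ∀ l, 1 ≤ l → l ≤ Z.card → (s l).card = k - 1 := by
    intro l h1 h2
    by_cases h : z l = 0
    · rw [hs0 l h]; exact hr.1
    · have hzt := hZt _ (hzZ l h1 h2)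
      rw [hs1 l h, card_sdiff_of_subset
        (singleton_subset_iff.2 (G.v_mem _ (Nat.pos_of_ne_zero h) hzt)), hcard _ (hET _ hzt)]
      simp
  have hssub : ∀ l, s l ⊆ E (z l) := by
    intro l
    by_cases h : z l = 0
    · rw [hs0 l h, h]; exact hrE
    · rw [hs1 l h]; exact sdiff_subset
  have hrank : ∀ l, 1 ≤ l → l ≤ Z.card → LayeredRank k L (s l) (w (z l)) := by
    intro l h1 h2
    have hzt := hZt _ (hzZ l h1 h2)
    refine ⟨G.w_pos _ hzt, ?_⟩
    intro n hn1 hn2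
    by_cases h : z l = 0
    · rw [h, G.w0] at hn1 hn2
      rw [hs0 l h]
      exact hL.root_inter n hn1 (by omega)
    · have hz0 := Nat.pos_of_ne_zero h
      have hcut := (mem_cuts.1 (hRC (hzR l h1 h2 h))).2.2.1
      have hmax : lay (v (z l)) + 1 = w (z l) + k := by
        rcases G.p_w _ hz0 hzt with h' | ⟨_, h', _⟩
        · omega
        · exact h'
      have hvL : v (z l) ∉ L n := by
        intro hv
        have := hlayL _ hzt _ (G.v_mem _ hz0 hzt) n hn1 (by omega) hv
        omega
      have heq : s l ∩ L n = E (z l) ∩ L n := by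
        rw [hs1 l h]
        ext u
        simp only [mem_inter, mem_sdiff, mem_singleton]
        constructor
        · rintro ⟨⟨a, _⟩, b⟩; exact ⟨a, b⟩
        · rintro ⟨a, b⟩
          refine ⟨⟨a, ?_⟩, b⟩
          rintro rfl; exact hvL b
      rw [heq]
      exact hwin _ hzt n hn1 (by omega)
  have hvert : ∀ l u, u ∈ hverts ((S l).image E) ↔ ∃ i, i < t ∧ rho p R i = z l ∧ u ∈ E i := by
    intro l u
    rw [mem_hverts]
    constructor
    · rintro ⟨e, he, hu⟩
      obtain ⟨i, hi, rfl⟩ := mem_image.1 he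
      rw [hS] at hi
      exact ⟨i, hi.1, hi.2, hu⟩
    · rintro ⟨i, h1, h2, h3⟩
      exact ⟨E i, mem_image_of_mem _ ((hS _ _).2 ⟨h1, h2⟩), h3⟩
  refine ⟨Z.card, fun l => (S l).image E, s, by omega, ?_, ?_, ?_, ?_, ?_, hs0 1 hz1,
    fun i h1 h2 => ⟨_, hrank i h1 h2⟩, ?_, ?_⟩
  · intro l h1 h2
    refine ⟨?_, ?_, hscard l h1 h2, E (z l), mem_image_of_mem _ (hzS l h1 h2), hssub l⟩
    · refine tight_of_index E v p (S l) (z l) (hzS l h1 h2) ?_ ?_ ?_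
      · intro i hi
        rw [hS] at hi
        rw [← hi.2]; exact rho_le G.p_lt R i
      · intro i hi
        exact hcard _ (hET i ((hS _ _).1 hi).1)
      · intro i hi hne
        rw [hS] at hi
        have hi0 : 0 < i := by
          rcases Nat.eq_zero_or_pos i with rfl | h
          · have := hi.2
            rw [rho_zero] at this
            exact absurd this hne
          · exact h
        have hiR : i ∉ R := by
          intro h
          have := hi.2
          rw [rho_of_mem h] at this
          exact hne this
        have hlt := G.p_lt i hi0
        refine ⟨(hS _ _).2 ⟨hlt.trans hi.1, ?_⟩, hlt, G.v_mem i hi0 hi.1,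
          fun j _ hj => G.v_new i hi0 hi.1 j hj, G.p_sub i hi0 hi.1⟩
        rw [← rho_step G.p_lt hi0 hiR]; exact hi.2
    · intro e he
      obtain ⟨i, hi, rfl⟩ := mem_image.1 he
      exact hET i ((hS _ _).1 hi).1
  · -- the number of pieces
    rw [hZc, le_div_iff₀ hβ0]
    push_cast
    have hΔd : (2 : ℝ) ≤ (Δ : ℝ) ^ d := by
      have h1 : (2 : ℝ) ≤ Δ := by exact_mod_cast hΔ
      calc (2 : ℝ) ≤ Δ := h1
        _ = (Δ : ℝ) ^ 1 := by simp
        _ ≤ (Δ : ℝ) ^ d := pow_le_pow_right₀ (by linarith) hd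
    rw [card_range, hM] at hRc
    push_cast at hRc
    have h2 : β * (R.card : ℝ) ≤ (Δ : ℝ) ^ d + 1 := by
      have : (β * (R.card : ℝ)) * t ≤ ((Δ : ℝ) ^ d + 1) * t := by linarith
      exact le_of_mul_le_mul_right this htR
    linarith
  · intro i j h1 h2 h3
    rw [disjoint_left]
    intro e he he'
    obtain ⟨a, ha, rfl⟩ := mem_image.1 he
    obtain ⟨b, hb, hab⟩ := mem_image.1 he'
    rw [hS] at ha hb
    have : b = a := hinj (mem_coe.2 (mem_range.2 hb.1)) (mem_coe.2 (mem_range.2 ha.1)) hab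
    have h4 := hzmono i j h1 h2 h3
    rw [this] at hb
    omega
  · ext e
    rw [mem_biUnion]
    constructor
    · rintro ⟨l, _, he⟩
      obtain ⟨i, hi, rfl⟩ := mem_image.1 he
      exact hET i ((hS _ _).1 hi).1
    · intro he
      rw [← himg] at he
      obtain ⟨i, hi, rfl⟩ := mem_image.1 he
      obtain ⟨l, h1, h2, h3⟩ := hzsurj _ (hrhoZ i)
      exact ⟨l, mem_Icc.2 ⟨h1, h2⟩, mem_image_of_mem _ ((hS _ _).2 ⟨mem_range.1 hi, h3.symm⟩)⟩
  · intro l h1 h2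
    refine le_trans ?_ (hRM (z l))
    have : S l ⊆ (range t).filter (fun i => rho p R i = z l) := by
      intro i hi
      rw [hS] at hi
      exact mem_filter.2 ⟨mem_range.2 hi.1, hi.2⟩
    exact_mod_cast card_image_le.trans (card_le_card this)
  · intro i l h1 h2 h3
    rw [disjoint_left]
    intro u hu hu'
    rw [mem_sdiff, hvert] at hu
    rw [hvert] at hu'
    obtain ⟨⟨b, hbt, hbr, hub⟩, hus⟩ := hu
    obtain ⟨a, hat, har, hua⟩ := hu'
    have hlt := hzmono i l h1 h2 h3
    have hz0 : z l ≠ 0 := by omega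
    rw [hs1 l hz0] at hus
    rcases G.vertex_root b hbt hub hbr (Or.inr hus) with h | ⟨j, hjt, huj, hjr, hjf⟩
    · exact hz0 h
    · have := G.root_le (R := R) huj hjf a hat hua
      omega
  · intro l h1 h2
    have hz0 : z l ≠ 0 := by
      have := hzmono 1 l le_rfl (by omega) h2
      omega
    have hzpos := Nat.pos_of_ne_zero hz0
    have hzt := hZt _ (hzZ l (by omega) h2)
    have hzC := hRC (hzR l (by omega) h2 hz0)
    have hplt := G.p_lt _ hzpos
    have hpt := hplt.trans hzt
    obtain ⟨i, hi1, hi2, hi3⟩ := hzsurj _ (hrhoZ (p (z l)))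
    have hle : z i ≤ p (z l) := by rw [hi3]; exact rho_le G.p_lt R _
    have hil : i < l := by
      by_contra hcon
      rcases Nat.lt_or_ge l i with h | h
      · have := hzmono l i (by omega) h hi2
        omega
      · have : i = l := by omega
        subst this; omega
    refine ⟨i, hi1, hil, ⟨hscard l (by omega) h2, E (p (z l)),
      mem_image_of_mem _ ((hS _ _).2 ⟨hpt, hi3.symm⟩), ?_⟩, w (z l), w (z i),
      hrank l (by omega) h2, hrank i hi1 hi2, ?_⟩
    · rw [hs1 l hz0]; exact G.p_sub _ hzpos hzt
    · have h3 : w (z i) ≤ w (p (z l)) := by rw [hi3]; exact G.w_le_of_rho _ hpt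
      have h4 := (mem_cuts.1 hzC).2.2.1
      have hzi : z i ∈ C ∨ z i = 0 := by
        rcases mem_insert.1 (hzZ i hi1 hi2) with h | h
        · exact Or.inr h
        · exact Or.inl (hRC h)
      obtain ⟨a, ha⟩ := G.cut_dvd hzi
      obtain ⟨b, hb⟩ := (mem_cuts.1 hzC).2.2.2
      have h5 := G.w_pos (z i) (hZt _ (hzZ i hi1 hi2))
      have h6 : d * a < d * b := by omega
      have h7 : a < b := Nat.lt_of_mul_lt_mul_left h6
      have h8 : d * (a + 1) ≤ d * b := Nat.mul_le_mul_left d h7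
      rw [Nat.mul_add, Nat.mul_one] at h8
      omega
end

section
/- For every integer h ≥ 1 and every real γ with 0 < γ ≤ 1 there exist μ_0 > 0 and, for each 0 < μ ≤ μ_0, an n_0, such that every k-graph H on n ≥ n_0 vertices has a (γ, μ, h)-reservoir, i.e. a set U ⊆ V(H) with: (i) (γ − μ)n ≤ |U| ≤ (γ + μ)n; (ii) for every family F ⊆ ∂H with |F| ≤ h, deg_H(F, U) ≥ (deg_H(F)/n − μ)|U|; and (iii) for every edge e of H, d^K_H(e, U) ≥ (d^K_H(e)/C(n−k, k) − μ)·C(|U|−k, k). -/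
open Finset

attribute [local instance] Classical.propDecidable

variable {α : Type*}

/-- `Q` describes a copy of `K^(k)(2)` in `H`: `Q` is a set of `k` pairwise disjoint pairs of
vertices such that every transversal (one vertex from each pair) is an edge of `H`. -/
def IsK2Copy [DecidableEq α] (k : ℕ) (H : Finset (Finset α)) (Q : Finset (Finset α)) : Prop :=
  Q.card = k ∧ (∀ p ∈ Q, p.card = 2) ∧
  (∀ p ∈ Q, ∀ q ∈ Q, p ≠ q → Disjoint p q) ∧
  (∀ e : Finset α, e ⊆ Q.sup id → (∀ p ∈ Q, (e ∩ p).card = 1) → e ∈ H)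

/-- `d^K_H(e)`: the number of copies of `K^(k)(2)` in `H` containing the edge `e`. -/
noncomputable def extCount [Fintype α] [DecidableEq α] (k : ℕ) (H : Finset (Finset α))
    (e : Finset α) : ℕ :=
  (Finset.univ.filter fun Q : Finset (Finset α) =>
    IsK2Copy k H Q ∧ e ⊆ Q.sup id ∧ ∀ p ∈ Q, (e ∩ p).card = 1).card

/-- The joint degree of a family `F` of `(k−1)`-sets in `H`. -/
def jointDeg [Fintype α] [DecidableEq α] (H : Finset (Finset α)) (F : Finset (Finset α)) : ℕ :=
  (Finset.univ.filter fun v => ∀ f ∈ F, insert v f ∈ H).card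

/-- The joint degree of `F` in `H` restricted to the set `U`. -/
def jointDegIn [DecidableEq α] (H : Finset (Finset α)) (F : Finset (Finset α))
    (U : Finset α) : ℕ :=
  (U.filter fun v => ∀ f ∈ F, insert v f ∈ H).card

/-- `d^K_H(e, U)`: the number of copies of `K^(k)(2)` in `H[U ∪ e]` containing the edge `e`. -/
noncomputable def extCountIn [Fintype α] [DecidableEq α] (k : ℕ) (H : Finset (Finset α))
    (e : Finset α) (U : Finset α) : ℕ :=
  (Finset.univ.filter fun Q : Finset (Finset α) =>
    IsK2Copy k H Q ∧ Q.sup id ⊆ U ∪ e ∧ e ⊆ Q.sup id ∧ ∀ p ∈ Q, (e ∩ p).card = 1).card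

section ReservoirHelpers

/-- Expectation of `f` over the `p`-random subset of `s`. -/
noncomputable def rExp {V : Type*} [DecidableEq V] (p : ℝ) (s : Finset V) (f : Finset V → ℝ) : ℝ :=
  ∑ t ∈ s.powerset, p ^ t.card * (1 - p) ^ (s.card - t.card) * f t

lemma rExp_empty {V : Type*} [DecidableEq V] (p : ℝ) (f : Finset V → ℝ) :
    rExp p ∅ f = f ∅ := by simp [rExp]

lemma rExp_insert {V : Type*} [DecidableEq V] (p : ℝ) {s : Finset V} {a : V} (ha : a ∉ s)
    (f : Finset V → ℝ) :
    rExp p (insert a s) f = (1 - p) * rExp p s f + p * rExp p s (fun t => f (insert a t)) := by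
  unfold rExp
  rw [Finset.sum_powerset_insert ha, Finset.mul_sum, Finset.mul_sum]
  congr 1
  · refine Finset.sum_congr rfl fun t ht => ?_
    have h1 : t.card ≤ s.card := Finset.card_le_card (Finset.mem_powerset.1 ht)
    rw [Finset.card_insert_of_notMem ha, Nat.succ_sub h1, pow_succ]
    ring
  · refine Finset.sum_congr rfl fun t ht => ?_
    have h2 : a ∉ t := fun h => ha (Finset.mem_powerset.1 ht h)
    rw [Finset.card_insert_of_notMem ha, Finset.card_insert_of_notMem h2, Nat.add_sub_add_right,
      pow_succ]
    ring

lemma rExp_mono {V : Type*} [DecidableEq V] {p : ℝ} (h0 : 0 ≤ p) (h1 : p ≤ 1) (s : Finset V)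
    {f g : Finset V → ℝ} (h : ∀ t, f t ≤ g t) : rExp p s f ≤ rExp p s g := by
  unfold rExp
  refine Finset.sum_le_sum fun t _ => mul_le_mul_of_nonneg_left (h t) ?_
  have : 0 ≤ 1 - p := by linarith
  positivity

lemma rExp_const {V : Type*} [DecidableEq V] (p : ℝ) (s : Finset V) (c : ℝ) :
    rExp p s (fun _ => c) = c := by
  unfold rExp
  rw [← Finset.sum_mul, Finset.sum_pow_mul_eq_add_pow]
  simp

lemma rExp_sum {V ι : Type*} [DecidableEq V] (p : ℝ) (s : Finset V) (G : Finset ι)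
    (f : ι → Finset V → ℝ) :
    rExp p s (fun t => ∑ i ∈ G, f i t) = ∑ i ∈ G, rExp p s (f i) := by
  unfold rExp
  simp_rw [Finset.mul_sum]
  exact Finset.sum_comm

lemma rExp_add {V : Type*} [DecidableEq V] (p : ℝ) (s : Finset V) (f g : Finset V → ℝ) :
    rExp p s (fun t => f t + g t) = rExp p s f + rExp p s g := by
  unfold rExp
  simp_rw [mul_add]
  exact Finset.sum_add_distrib

lemma rExp_smul {V : Type*} [DecidableEq V] (p : ℝ) (s : Finset V) (c : ℝ) (f : Finset V → ℝ) :
    rExp p s (fun t => c * f t) = c * rExp p s f := by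
  unfold rExp
  rw [Finset.mul_sum]
  exact Finset.sum_congr rfl fun t _ => by ring

lemma rExp_ind {V : Type*} [DecidableEq V] (p : ℝ) (s : Finset V) : ∀ A : Finset V, A ⊆ s →
    rExp p s (fun t => if A ⊆ t then 1 else 0) = p ^ A.card := by
  induction s using Finset.induction_on with
  | empty => intro A hA; rw [Finset.subset_empty.1 hA]; simp [rExp_empty]
  | insert a s ha ih =>
    intro A hA
    rw [rExp_insert p ha]
    by_cases haA : a ∈ A
    · have h1 : rExp p s (fun t => if A ⊆ t then (1:ℝ) else 0) = 0 := by
        unfold rExp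
        refine Finset.sum_eq_zero fun t ht => ?_
        have hneg : ¬ A ⊆ t := fun h => ha (Finset.mem_powerset.1 ht (h haA))
        simp only [if_neg hneg, mul_zero]
      have h2 := ih (A.erase a) (by
        intro x hx
        have := hA (Finset.mem_of_mem_erase hx)
        exact (Finset.mem_insert.1 this).resolve_left (Finset.ne_of_mem_erase hx))
      have h3 : (fun t : Finset V => if A ⊆ insert a t then (1:ℝ) else 0)
          = fun t => if A.erase a ⊆ t then 1 else 0 := by
        funext t
        simp only [Finset.subset_insert_iff]
      rw [h1, h3, h2, ← Finset.card_erase_add_one haA, pow_succ]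
      ring
    · have h3 : (fun t : Finset V => if A ⊆ insert a t then (1:ℝ) else 0)
          = fun t => if A ⊆ t then 1 else 0 := by
        funext t
        simp only [Finset.subset_insert_iff_of_notMem haA]
      rw [h3, ih A ((Finset.subset_insert_iff_of_notMem haA).1 hA)]
      ring

lemma two_point {p x y d : ℝ} (h0 : 0 ≤ p) (h1 : p ≤ 1) (hd : |x - y| ≤ d) (hd1 : d ≤ 1) :
    (1 - p) * Real.exp x + p * Real.exp y ≤ Real.exp ((1 - p) * x + p * y + d ^ 2) := by
  set m := (1 - p) * x + p * y with hm
  have key : ∀ z : ℝ, |z| ≤ d → Real.exp z ≤ 1 + z + d ^ 2 := by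
    intro z hz
    have := Real.abs_exp_sub_one_sub_id_le (hz.trans hd1)
    have h2 := (abs_le.1 this).2
    have h3 : z ^ 2 ≤ d ^ 2 := sq_le_sq' (by linarith [(abs_le.1 hz).1]) (abs_le.1 hz).2
    linarith
  have hd0 : 0 ≤ d := (abs_nonneg _).trans hd
  have hx : |x - m| ≤ d := by
    have : x - m = p * (x - y) := by rw [hm]; ring
    rw [this, abs_mul, abs_of_nonneg h0]
    nlinarith [abs_nonneg (x - y)]
  have hy : |y - m| ≤ d := by
    have : y - m = -((1 - p) * (x - y)) := by rw [hm]; ring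
    rw [this, abs_neg, abs_mul, abs_of_nonneg (by linarith : 0 ≤ 1 - p)]
    nlinarith [abs_nonneg (x - y)]
  have e1 : Real.exp x = Real.exp m * Real.exp (x - m) := by rw [← Real.exp_add]; ring_nf
  have e2 : Real.exp y = Real.exp m * Real.exp (y - m) := by rw [← Real.exp_add]; ring_nf
  rw [e1, e2, Real.exp_add m]
  have : (1 - p) * Real.exp (x - m) + p * Real.exp (y - m) ≤ Real.exp (d ^ 2) := by
    have a1 := mul_le_mul_of_nonneg_left (key _ hx) (by linarith : 0 ≤ 1 - p)
    have a2 := mul_le_mul_of_nonneg_left (key _ hy) h0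
    have a3 := Real.add_one_le_exp (d ^ 2)
    have : (1 - p) * (1 + (x - m) + d ^ 2) + p * (1 + (y - m) + d ^ 2) = d ^ 2 + 1 := by
      rw [hm]; ring
    linarith
  nlinarith [Real.exp_pos m]

lemma rExp_mgf {V : Type*} [DecidableEq V] {p : ℝ} (h0 : 0 ≤ p) (h1 : p ≤ 1) {c : ℝ}
    (hc1 : c ≤ 1) (s : Finset V) : ∀ f : Finset V → ℝ,
    (∀ v t, |f (insert v t) - f t| ≤ c) →
    rExp p s (fun t => Real.exp (f t)) ≤ Real.exp (rExp p s f + c ^ 2 * s.card) := by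
  induction s using Finset.induction_on with
  | empty => intro f _; simp [rExp_empty]
  | insert a s ha ih =>
    intro f hf
    rw [rExp_insert p ha, rExp_insert p ha]
    have i1 := ih f hf
    have i2 := ih (fun t => f (insert a t)) (by
      intro v t
      have := hf v (insert a t)
      rwa [Finset.insert_comm] at this)
    set m0 := rExp p s f
    set m1 := rExp p s (fun t => f (insert a t))
    have hle : m1 ≤ m0 + c := by
      have := rExp_mono h0 h1 s (f := fun t => f (insert a t)) (g := fun t => f t + c)
        (fun t => by linarith [(abs_le.1 (hf a t)).2])
      rwa [rExp_add, rExp_const] at this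
    have hge : m0 ≤ m1 + c := by
      have := rExp_mono h0 h1 s (f := f) (g := fun t => f (insert a t) + c)
        (fun t => by linarith [(abs_le.1 (hf a t)).1])
      rwa [rExp_add, rExp_const] at this
    have hd : |m0 - m1| ≤ c := abs_le.2 ⟨by linarith, by linarith⟩
    have tp := two_point h0 h1 hd hc1
    rw [Finset.card_insert_of_notMem ha]
    have hq : 0 ≤ 1 - p := by linarith
    calc _ ≤ (1 - p) * Real.exp (m0 + c ^ 2 * s.card) + p * Real.exp (m1 + c ^ 2 * s.card) := by
            gcongr
      _ = ((1 - p) * Real.exp m0 + p * Real.exp m1) * Real.exp (c ^ 2 * s.card) := by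
            rw [Real.exp_add, Real.exp_add]; ring
      _ ≤ Real.exp ((1 - p) * m0 + p * m1 + c ^ 2) * Real.exp (c ^ 2 * s.card) := by gcongr
      _ = _ := by rw [← Real.exp_add]; push_cast; ring_nf

lemma exists_good {V : Type*} [DecidableEq V] {p : ℝ} (h0 : 0 ≤ p) (h1 : p ≤ 1)
    {c lam T : ℝ} (hlam : 0 < lam) (hc1 : lam * c ≤ 1) (s : Finset V)
    (G : Finset (Finset V → ℝ)) (hG : ∀ f ∈ G, ∀ v t, |f (insert v t) - f t| ≤ c)
    (hcard : G.card * Real.exp ((lam * c) ^ 2 * s.card - lam * T) < 1) :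
    ∃ U : Finset V, ∀ f ∈ G, rExp p s f - T ≤ f U := by
  by_contra! hcon
  have hpt : ∀ t : Finset V, (1:ℝ) ≤ ∑ f ∈ G,
      Real.exp (lam * (rExp p s f - T)) * Real.exp ((-lam) * f t) := by
    intro t
    obtain ⟨f, hf, hlt⟩ := hcon t
    refine le_trans ?_ (Finset.single_le_sum (f := fun f : Finset V → ℝ =>
      Real.exp (lam * (rExp p s f - T)) * Real.exp ((-lam) * f t)) (fun i _ => by positivity) hf)
    rw [← Real.exp_add]
    apply Real.one_le_exp
    nlinarith
  have h2 := rExp_mono h0 h1 s hpt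
  rw [rExp_const, rExp_sum] at h2
  have h3 : ∑ f ∈ G, rExp p s (fun t => Real.exp (lam * (rExp p s f - T)) *
      Real.exp ((-lam) * f t)) ≤ ∑ f ∈ G, Real.exp ((lam * c) ^ 2 * s.card - lam * T) := by
    refine Finset.sum_le_sum fun f hf => ?_
    rw [rExp_smul]
    have := rExp_mgf h0 h1 hc1 s (fun t => (-lam) * f t) (by
      intro v t
      rw [← mul_sub, abs_mul, abs_neg, abs_of_pos hlam]
      exact mul_le_mul_of_nonneg_left (hG f hf v t) hlam.le)
    rw [rExp_smul] at this
    calc _ ≤ Real.exp (lam * (rExp p s f - T)) *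
          Real.exp (-lam * rExp p s f + (lam * c) ^ 2 * s.card) := by gcongr
      _ = _ := by rw [← Real.exp_add]; ring_nf
  rw [Finset.sum_const, nsmul_eq_mul] at h3
  linarith

lemma count_exp {V ι : Type*} [Fintype V] [DecidableEq V] (p : ℝ) (G : Finset ι)
    (A : ι → Finset V) (j : ℕ) (hA : ∀ q ∈ G, (A q).card = j) :
    rExp p univ (fun t => ((G.filter fun q => A q ⊆ t).card : ℝ)) = p ^ j * G.card := by
  have : (fun t : Finset V => ((G.filter fun q => A q ⊆ t).card : ℝ))
      = fun t => ∑ q ∈ G, if A q ⊆ t then (1:ℝ) else 0 := by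
    funext t
    rw [Finset.card_filter]; push_cast; rfl
  rw [this, rExp_sum, Finset.sum_congr rfl (g := fun _ => p ^ j)]
  · simp [mul_comm]
  · intro q hq
    rw [← hA q hq]
    exact rExp_ind p univ _ (Finset.subset_univ _)

lemma count_diff {V ι : Type*} [DecidableEq V] (G : Finset ι)
    (A : ι → Finset V) (c : ℝ) (v : V) (hA : ((G.filter fun q => v ∈ A q).card : ℝ) ≤ c)
    (t : Finset V) :
    |((G.filter fun q => A q ⊆ insert v t).card : ℝ) - ((G.filter fun q => A q ⊆ t).card : ℝ)|
      ≤ c := by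
  classical
  have h1 : (G.filter fun q => A q ⊆ t) ⊆ (G.filter fun q => A q ⊆ insert v t) := by
    intro q hq
    rw [Finset.mem_filter] at hq ⊢
    exact ⟨hq.1, hq.2.trans (Finset.subset_insert _ _)⟩
  have h2 : (G.filter fun q => A q ⊆ insert v t) ⊆
      (G.filter fun q => A q ⊆ t) ∪ (G.filter fun q => v ∈ A q) := by
    intro q hq
    rw [Finset.mem_union, Finset.mem_filter, Finset.mem_filter]
    rw [Finset.mem_filter] at hq
    by_cases hv : v ∈ A q
    · exact Or.inr ⟨hq.1, hv⟩
    · exact Or.inl ⟨hq.1, (Finset.subset_insert_iff_of_notMem hv).1 hq.2⟩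
  have h3 := Finset.card_le_card h1
  have h4 := (Finset.card_le_card h2).trans (Finset.card_union_le _ _)
  have h3' : ((G.filter fun q => A q ⊆ t).card : ℝ) ≤
    ((G.filter fun q => A q ⊆ insert v t).card : ℝ) := by exact_mod_cast h3
  have h4' : ((G.filter fun q => A q ⊆ insert v t).card : ℝ) ≤
    ((G.filter fun q => A q ⊆ t).card : ℝ) + ((G.filter fun q => v ∈ A q).card : ℝ) := by
      exact_mod_cast h4
  rw [abs_le]
  constructor <;> linarith [abs_nonneg c]

lemma mem_sets_card {n k : ℕ} (v : Fin n) (S : Finset (Finset (Fin n)))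
    (hS : ∀ a ∈ S, v ∈ a ∧ a.card = k) : S.card ≤ n ^ (k - 1) := by
  have : S.card ≤ (powersetCard (k - 1) (univ : Finset (Fin n))).card := by
    refine Finset.card_le_card_of_injOn (fun a => a.erase v) ?_ ?_
    · intro a ha
      have := hS a ha
      simp [Finset.mem_powersetCard, Finset.card_erase_of_mem this.1, this.2]
    · intro a ha b hb hab
      have h1 := (hS a ha).1
      have h2 := (hS b hb).1
      rw [← Finset.insert_erase h1, ← Finset.insert_erase h2]
      exact congrArg (insert v) hab
  rw [Finset.card_powersetCard, Finset.card_univ, Fintype.card_fin] at this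
  exact this.trans (Nat.choose_le_pow _ _)

lemma ksets_card {n k : ℕ} (S : Finset (Finset (Fin n)))
    (hS : ∀ a ∈ S, a.card = k) : S.card ≤ n ^ k := by
  have : S ⊆ powersetCard k (univ : Finset (Fin n)) := by
    intro a ha
    simp [Finset.mem_powersetCard, hS a ha]
  have := Finset.card_le_card this
  rw [Finset.card_powersetCard, Finset.card_univ, Fintype.card_fin] at this
  exact this.trans (Nat.choose_le_pow _ _)

/-- multiplicity of `Q ↦ Q.sup id \ e` -/
lemma copies_mult {n k : ℕ} (e : Finset (Fin n)) (he : e.card = k)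
    (G : Finset (Finset (Finset (Fin n))))
    (hG : ∀ Q ∈ G, (Q.sup id \ e).card = k) :
    G.card ≤ 2 ^ 2 ^ (2 * k) * (G.image fun Q => Q.sup id \ e).card := by
  refine Finset.card_le_mul_card_image _ _ ?_
  intro a ha
  obtain ⟨Q0, hQ0, rfl⟩ := Finset.mem_image.1 ha
  set a := Q0.sup id \ e
  have hsub : (G.filter fun Q => Q.sup id \ e = a) ⊆ (a ∪ e).powerset.powerset := by
    intro Q hQ
    rw [Finset.mem_filter] at hQ
    rw [Finset.mem_powerset]
    intro q hq
    rw [Finset.mem_powerset, ← hQ.2]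
    have : q ⊆ Q.sup id := Finset.le_sup (f := id) hq
    rw [Finset.sdiff_union_self_eq_union]
    exact this.trans Finset.subset_union_left
  refine (Finset.card_le_card hsub).trans ?_
  rw [Finset.card_powerset, Finset.card_powerset]
  have : (a ∪ e).card ≤ 2 * k := by
    have := Finset.card_union_le a e
    have h2 : a.card = k := hG Q0 hQ0
    omega
  gcongr <;> norm_num

lemma K2_sdiff_card {n k : ℕ} (H : Finset (Finset (Fin n))) (e : Finset (Fin n)) (he : e.card = k)
    (Q : Finset (Finset (Fin n))) (hQ : IsK2Copy k H Q) (heQ : e ⊆ Q.sup id) :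
    (Q.sup id \ e).card = k := by
  have : (Q.sup id).card = 2 * k := by
    rw [Finset.sup_eq_biUnion, Finset.card_biUnion]
    · rw [Finset.sum_congr rfl (g := fun _ => 2)]
      · simp [hQ.1, mul_comm]
      · intro p hp; exact hQ.2.1 p hp
    · intro p hp q hq hpq
      exact hQ.2.2.1 p hp q hq hpq
  rw [Finset.card_sdiff_of_subset heQ]
  omega

lemma descFact_ratio (k n u : ℕ) (hu : u ≤ n) (j : ℕ) :
    (u - j).descFactorial k * n ^ k ≤ (n - j).descFactorial k * u ^ k := by
  induction k with
  | zero => simp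
  | succ k ih =>
    rw [Nat.descFactorial_succ, Nat.descFactorial_succ, pow_succ, pow_succ]
    have h : (u - j - k) * n ≤ (n - j - k) * u := by
      rw [Nat.sub_sub, Nat.sub_sub, Nat.sub_mul, Nat.sub_mul, mul_comm u n]
      exact Nat.sub_le_sub_left (Nat.mul_le_mul_left _ hu) _
    calc _ = ((u - j - k) * n) * ((u - j).descFactorial k * n ^ k) := by ring
      _ ≤ ((n - j - k) * u) * ((n - j).descFactorial k * u ^ k) := Nat.mul_le_mul h ih
      _ = _ := by ring

lemma choose_ratio (k n u : ℕ) (hu : u ≤ n) (j : ℕ) :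
    (u - j).choose k * n ^ k ≤ (n - j).choose k * u ^ k := by
  have := descFact_ratio k n u hu j
  rw [Nat.descFactorial_eq_factorial_mul_choose, Nat.descFactorial_eq_factorial_mul_choose,
    mul_assoc, mul_assoc] at this
  exact Nat.le_of_mul_le_mul_left this (Nat.factorial_pos k)

lemma eventually_small (C c : ℝ) (hc : 0 < c) (m : ℕ) :
    ∃ n₀ : ℕ, ∀ n : ℕ, n₀ ≤ n → C * (n:ℝ) ^ m * Real.exp (-(c * n)) < 1 := by
  have h1 := (Real.tendsto_pow_mul_exp_neg_atTop_nhds_zero m).comp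
    ((tendsto_natCast_atTop_atTop (R := ℝ)).const_mul_atTop hc)
  have h2 := h1.const_mul (C / c ^ m)
  rw [mul_zero] at h2
  obtain ⟨n₀, hn₀⟩ := Filter.eventually_atTop.1 (h2.eventually (gt_mem_nhds one_pos))
  refine ⟨n₀, fun n hn => ?_⟩
  have := hn₀ n hn
  simp only [Function.comp] at this
  have e : C / c ^ m * ((c * (n:ℝ)) ^ m * Real.exp (-(c * n)))
      = C * (n:ℝ) ^ m * Real.exp (-(c * n)) := by
    rw [mul_pow]
    field_simp
  rw [← e]
  exact this

lemma fam_card (n k h : ℕ) (hn : 1 ≤ n) :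
    ((Finset.range (h+1)).biUnion fun i => powersetCard i
      (powersetCard (k-1) (univ : Finset (Fin n)))).card ≤ (h+1) * n ^ (k * h) := by
  refine Finset.card_biUnion_le.trans ?_
  refine (Finset.sum_le_card_nsmul _ _ (n ^ (k*h)) ?_).trans (by simp)
  intro i hi
  rw [Finset.card_powersetCard, Finset.card_powersetCard, Finset.card_univ, Fintype.card_fin]
  calc _ ≤ (n.choose (k-1)) ^ i := Nat.choose_le_pow _ _
    _ ≤ (n ^ (k-1)) ^ i := Nat.pow_le_pow_left (Nat.choose_le_pow _ _) _
    _ = n ^ ((k-1) * i) := by rw [pow_mul]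
    _ ≤ n ^ (k * h) := Nat.pow_le_pow_right hn
        (Nat.mul_le_mul (Nat.sub_le _ _) (by simpa [Nat.lt_succ_iff] using hi))

lemma numeric_iii (k n u : ℕ) (γ μ ε B X Y : ℝ) (hk : 2 ≤ k) (hγ0 : 0 < γ) (hγ1 : γ ≤ 1)
    (hε0 : 0 < ε) (hεγ : ε ≤ γ / 2) (hμ : 0 < μ) (hB : 0 ≤ B)
    (hε : (B * k * 2 ^ k + 1) * ε ≤ μ * ((γ / 4) ^ k / (k.factorial : ℝ)))
    (hn : 8 * k ≤ γ * n) (hun : u ≤ n)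
    (hu1 : (γ - ε) * n ≤ u) (hu2 : (u : ℝ) ≤ (γ + ε) * n)
    (hX0 : 0 ≤ X) (hX : X ≤ B * (n:ℝ) ^ k) (hY : γ ^ k * X - ε * (n:ℝ) ^ k ≤ Y) :
    (X / (((n - k).choose k : ℕ) : ℝ) - μ) * (((u - k).choose k : ℕ) : ℝ) ≤ Y := by
  have hk0 : (0:ℝ) < k := by positivity
  have hn0' : (0:ℝ) < n := by
    by_contra hcon
    have : (n:ℝ) = 0 := le_antisymm (not_lt.1 hcon) (Nat.cast_nonneg _)
    rw [this] at hn; linarith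
  have hnn : (8 * k : ℝ) ≤ n := by nlinarith
  have hnn' : 8 * k ≤ n := by exact_mod_cast hnn
  have hN : (0:ℝ) < (((n - k).choose k : ℕ) : ℝ) := by
    exact_mod_cast Nat.choose_pos (by omega)
  set N := (((n - k).choose k : ℕ) : ℝ) with hNdef
  set M := (((u - k).choose k : ℕ) : ℝ) with hMdef
  have hM0 : 0 ≤ M := Nat.cast_nonneg _
  have hr : M * (n:ℝ) ^ k ≤ N * (u:ℝ) ^ k := by
    rw [hMdef, hNdef]
    exact_mod_cast choose_ratio k n u hun k
  have hpow : (u:ℝ) ^ k ≤ ((γ + ε) * n) ^ k := by gcongr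
  have hdiff : (γ + ε) ^ k - γ ^ k ≤ ε * k * 2 ^ k := by
    have h1 := abs_pow_sub_pow_le (γ + ε) γ k
    have h2 : max |γ + ε| |γ| ≤ 2 := by
      rw [abs_of_pos hγ0, abs_of_pos (by linarith)]
      exact max_le (by linarith) (by linarith)
    have h3 : (max |γ + ε| |γ|) ^ (k - 1) ≤ 2 ^ k := by
      calc _ ≤ (2:ℝ) ^ (k - 1) := by gcongr
        _ ≤ 2 ^ k := pow_le_pow_right₀ (by norm_num) (Nat.sub_le _ _)
    have h4 : |γ + ε - γ| = ε := by rw [add_sub_cancel_left, abs_of_pos hε0]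
    rw [h4] at h1
    calc _ ≤ _ := le_abs_self _
      _ ≤ _ := h1
      _ ≤ _ := by gcongr
  have hnk : (0:ℝ) < (n:ℝ) ^ k := by positivity
  have hMN : M / N ≤ (γ + ε) ^ k := by
    rw [div_le_iff₀ hN]
    rw [mul_pow] at hpow
    have : M * (n:ℝ) ^ k ≤ ((γ + ε) ^ k * N) * (n:ℝ) ^ k := by nlinarith
    exact le_of_mul_le_mul_right this hnk
  have h5 : X * (M / N) ≤ γ ^ k * X + B * (n:ℝ) ^ k * (ε * k * 2 ^ k) := by
    have h6 : M / N ≤ γ ^ k + ε * k * 2 ^ k := by linarith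
    calc X * (M / N) ≤ X * (γ ^ k + ε * k * 2 ^ k) := by gcongr
      _ = γ ^ k * X + X * (ε * k * 2 ^ k) := by ring
      _ ≤ _ := by gcongr
  have hu3 : γ / 2 * n ≤ u := by nlinarith
  have hMl : (γ / 4) ^ k / (k.factorial : ℝ) * (n:ℝ) ^ k ≤ M := by
    have h7 := Nat.pow_le_choose (α := ℝ) k (u - k)
    refine le_trans ?_ h7
    have h8 : γ / 4 * n ≤ ((u - k + 1 - k : ℕ) : ℝ) := by
      have h9 : u ≤ (u - k + 1 - k) + 2 * k := by omega
      have h10 : (u:ℝ) ≤ ((u - k + 1 - k : ℕ) : ℝ) + 2 * k := by exact_mod_cast h9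
      linarith
    rw [div_mul_eq_mul_div, ← mul_pow]
    gcongr
  have h11 : (B * k * 2 ^ k + 1) * ε * (n:ℝ) ^ k ≤ μ * M := by
    calc _ ≤ μ * ((γ / 4) ^ k / (k.factorial : ℝ)) * (n:ℝ) ^ k := by gcongr
      _ = μ * ((γ / 4) ^ k / (k.factorial : ℝ) * (n:ℝ) ^ k) := by ring
      _ ≤ _ := by gcongr
  have h12 : (X / N - μ) * M = X * (M / N) - μ * M := by ring
  rw [h12]
  linarith

/-- copies through `e` -/
noncomputable def copiesAt {n : ℕ} (k : ℕ) (H : Finset (Finset (Fin n))) (e : Finset (Fin n)) :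
    Finset (Finset (Finset (Fin n))) :=
  Finset.univ.filter fun Q : Finset (Finset (Fin n)) =>
    IsK2Copy k H Q ∧ e ⊆ Q.sup id ∧ ∀ p ∈ Q, (e ∩ p).card = 1

lemma extCountIn_eq {n : ℕ} (k : ℕ) (H : Finset (Finset (Fin n))) (e S : Finset (Fin n)) :
    extCountIn k H e S = ((copiesAt k H e).filter fun Q => Q.sup id \ e ⊆ S).card := by
  unfold extCountIn copiesAt
  rw [Finset.filter_filter]
  congr 1
  ext Q
  simp only [Finset.mem_filter, Finset.mem_univ, true_and]
  have : Q.sup id \ e ⊆ S ↔ Q.sup id ⊆ S ∪ e := by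
    rw [Finset.union_comm S e]
    exact sdiff_le_iff
  rw [this]
  tauto

lemma copies_sdiff_card {n k : ℕ} (H : Finset (Finset (Fin n))) (e : Finset (Fin n))
    (he : e.card = k) : ∀ Q ∈ copiesAt k H e, (Q.sup id \ e).card = k := by
  intro Q hQ
  simp only [copiesAt, Finset.mem_filter, Finset.mem_univ, true_and] at hQ
  exact K2_sdiff_card H e he Q hQ.1 hQ.2.1

lemma copies_card {n k : ℕ} (H : Finset (Finset (Fin n))) (e : Finset (Fin n))
    (he : e.card = k) : (copiesAt k H e).card ≤ 2 ^ 2 ^ (2 * k) * n ^ k := by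
  refine (copies_mult e he _ (copies_sdiff_card H e he)).trans ?_
  gcongr
  apply ksets_card
  intro a ha
  obtain ⟨Q, hQ, rfl⟩ := Finset.mem_image.1 ha
  exact copies_sdiff_card H e he Q hQ

lemma copies_card_mem {n k : ℕ} (H : Finset (Finset (Fin n))) (e : Finset (Fin n))
    (he : e.card = k) (v : Fin n) :
    ((copiesAt k H e).filter fun Q => v ∈ Q.sup id \ e).card
      ≤ 2 ^ 2 ^ (2 * k) * n ^ (k - 1) := by
  refine (copies_mult e he _ (fun Q hQ =>
    copies_sdiff_card H e he Q (Finset.mem_filter.1 hQ).1)).trans ?_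
  gcongr
  apply mem_sets_card v
  intro a ha
  obtain ⟨Q, hQ, rfl⟩ := Finset.mem_image.1 ha
  rw [Finset.mem_filter] at hQ
  exact ⟨hQ.2, copies_sdiff_card H e he Q hQ.1⟩

lemma jointDegIn_eq {n : ℕ} (H F : Finset (Finset (Fin n))) (S : Finset (Fin n)) :
    jointDegIn H F S =
      (((univ : Finset (Fin n)).filter fun v => ∀ f ∈ F, insert v f ∈ H).filter
        fun v => ({v} : Finset (Fin n)) ⊆ S).card := by
  unfold jointDegIn
  congr 1
  ext v
  simp [and_comm]

lemma card_eq_count {n : ℕ} (S : Finset (Fin n)) :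
    S.card = ((univ : Finset (Fin n)).filter fun v => ({v} : Finset (Fin n)) ⊆ S).card := by
  congr 1
  ext v
  simp

lemma single_count {n : ℕ} (D : Finset (Fin n)) (v : Fin n) :
    ((D.filter fun w => v ∈ ({w} : Finset (Fin n))).card : ℝ) ≤ 1 := by
  have : (D.filter fun w => v ∈ ({w} : Finset (Fin n))).card ≤ 1 := by
    refine Finset.card_le_one.2 ?_
    intro a ha b hb
    simp only [Finset.mem_filter, Finset.mem_singleton] at ha hb
    rw [← ha.2, ← hb.2]
  exact_mod_cast this

end ReservoirHelpers

set_option maxHeartbeats 2000000 in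
/-- For every `h ≥ 1` and `0 < γ ≤ 1` there is `μ₀ > 0` such that for each
`0 < μ ≤ μ₀` there is `n₀` such that every `k`-graph `H` on `n ≥ n₀` vertices has a
`(γ, μ, h)`-reservoir. -/
theorem reservoir_exists (k h : ℕ) (hk : 2 ≤ k) (hh : 1 ≤ h)
    (γ : ℝ) (hγ0 : 0 < γ) (hγ1 : γ ≤ 1) :
    ∃ μ₀ : ℝ, 0 < μ₀ ∧
      ∀ μ : ℝ, 0 < μ → μ ≤ μ₀ →
      ∃ n₀ : ℕ, ∀ n : ℕ, n₀ ≤ n →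
      ∀ H : Finset (Finset (Fin n)), (∀ e ∈ H, e.card = k) →
      ∃ U : Finset (Fin n),
        -- (i)
        ((γ - μ) * (n : ℝ) ≤ (U.card : ℝ) ∧ (U.card : ℝ) ≤ (γ + μ) * (n : ℝ)) ∧
        -- (ii)
        (∀ F : Finset (Finset (Fin n)), (∀ f ∈ F, InShadow k H f) → F.card ≤ h →
          ((jointDeg H F : ℝ) / (n : ℝ) - μ) * (U.card : ℝ) ≤ (jointDegIn H F U : ℝ)) ∧
        -- (iii)
        (∀ e ∈ H,
          ((extCount k H e : ℝ) / (((n - k).choose k : ℕ) : ℝ) - μ)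
              * (((U.card - k).choose k : ℕ) : ℝ)
            ≤ (extCountIn k H e U : ℝ)) := by
  refine ⟨1, one_pos, fun μ hμ hμ1 => ?_⟩
  set B : ℝ := 2 ^ 2 ^ (2 * k) with hB
  have hB1 : 1 ≤ B := one_le_pow₀ (by norm_num)
  have hB0 : 0 < B := by linarith
  have hD : 0 < B * k * 2 ^ k + 1 := by positivity
  have hR : 0 < μ * ((γ / 4) ^ k / (k.factorial : ℝ)) / (B * k * 2 ^ k + 1) := by positivity
  obtain ⟨ε, hε0, hε1, hε2⟩ : ∃ ε : ℝ, 0 < ε ∧ ε ≤ μ * γ / 4 ∧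
      ε ≤ μ * ((γ / 4) ^ k / (k.factorial : ℝ)) / (B * k * 2 ^ k + 1) :=
    ⟨min (μ * γ / 4) _, lt_min (by positivity) hR, min_le_left _ _, min_le_right _ _⟩
  have hε3 : (B * k * 2 ^ k + 1) * ε ≤ μ * ((γ / 4) ^ k / (k.factorial : ℝ)) := by
    rw [le_div_iff₀ hD] at hε2
    linarith
  have hμγ : μ * γ ≤ γ := by nlinarith
  have hμγ' : μ * γ ≤ μ := by nlinarith
  set lam : ℝ := ε / (2 * B ^ 2) with hlam
  have hlam0 : 0 < lam := by positivity
  have hlamB : lam * B ≤ 1 := by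
    have : lam * B = ε / (2 * B) := by rw [hlam]; field_simp
    rw [this, div_le_one (by positivity)]
    linarith
  obtain ⟨n₁, hn₁⟩ := eventually_small (h + 4) (ε ^ 2 / (4 * B ^ 2)) (by positivity) (k * h + k)
  obtain ⟨n₂, hn₂⟩ := exists_nat_ge (8 * k / γ)
  refine ⟨max (max n₁ n₂) 1, fun n hn H hH => ?_⟩
  have hnn₁ : n₁ ≤ n := le_trans (le_max_left _ _) (le_trans (le_max_left _ _) hn)
  have hnn₂ : n₂ ≤ n := le_trans (le_max_right _ _) (le_trans (le_max_left _ _) hn)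
  have hn1 : 1 ≤ n := le_trans (le_max_right _ _) hn
  have hnR : (0:ℝ) < n := by exact_mod_cast hn1
  have hn8 : 8 * k ≤ γ * n := by
    have : 8 * k / γ ≤ (n:ℝ) := hn₂.trans (by exact_mod_cast hnn₂)
    rw [div_le_iff₀ hγ0] at this
    linarith
  -- the family of functions
  set FF := ((Finset.range (h+1)).biUnion fun i => powersetCard i
      (powersetCard (k-1) (univ : Finset (Fin n)))) with hFF
  set g1 : Finset (Fin n) → ℝ := fun S => (S.card : ℝ) with hg1
  set g2 : Finset (Fin n) → ℝ := fun S => (-1) * (S.card : ℝ) with hg2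
  set gF : Finset (Finset (Fin n)) → Finset (Fin n) → ℝ :=
    fun F S => (jointDegIn H F S : ℝ) with hgF
  set ge : Finset (Fin n) → Finset (Fin n) → ℝ :=
    fun e S => ((n:ℝ) ^ (k - 1))⁻¹ * (extCountIn k H e S : ℝ) with hge
  set G : Finset (Finset (Fin n) → ℝ) := {g1, g2} ∪ (FF.image gF ∪ H.image ge) with hG
  have hGcard : (G.card : ℝ) ≤ (h + 4) * (n:ℝ) ^ (k * h + k) := by
    have a1 : ({g1, g2} : Finset (Finset (Fin n) → ℝ)).card ≤ 2 := Finset.card_le_two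
    have a2 : (FF.image gF).card ≤ (h+1) * n ^ (k * h) :=
      Finset.card_image_le.trans (fam_card n k h hn1)
    have a3 : (H.image ge).card ≤ n ^ k := Finset.card_image_le.trans (ksets_card H hH)
    have a4 : G.card ≤ 2 + ((h+1) * n ^ (k * h) + n ^ k) :=
      (Finset.card_union_le _ _).trans (Nat.add_le_add a1
        ((Finset.card_union_le _ _).trans (Nat.add_le_add a2 a3)))
    have b1 : n ^ (k * h) ≤ n ^ (k * h + k) := Nat.pow_le_pow_right hn1 (by omega)
    have b2 : n ^ k ≤ n ^ (k * h + k) := Nat.pow_le_pow_right hn1 (by omega)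
    have b3 : 1 ≤ n ^ (k * h + k) := Nat.one_le_pow _ _ hn1
    have a5 : G.card ≤ (h + 4) * n ^ (k * h + k) := by nlinarith
    exact_mod_cast a5
  have hGdiff : ∀ f ∈ G, ∀ v t, |f (insert v t) - f t| ≤ B := by
    intro f hf v t
    rw [hG, Finset.mem_union, Finset.mem_union, Finset.mem_insert, Finset.mem_singleton,
      Finset.mem_image, Finset.mem_image] at hf
    have hc : |((insert v t).card : ℝ) - (t.card : ℝ)| ≤ 1 := by
      rw [card_eq_count (insert v t), card_eq_count t]
      exact count_diff _ _ 1 v (single_count _ v) t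
    rcases hf with (rfl | rfl) | ⟨F, hF, rfl⟩ | ⟨e, he, rfl⟩
    · exact hc.trans hB1
    · simp only [hg2]
      rw [← mul_sub, abs_mul, abs_neg, abs_one, one_mul]
      exact hc.trans hB1
    · simp only [hgF, jointDegIn_eq]
      exact (count_diff _ _ 1 v (single_count _ v) t).trans hB1
    · simp only [hge, extCountIn_eq]
      rw [← mul_sub, abs_mul, abs_of_pos (by positivity), inv_mul_le_iff₀ (by positivity)]
      refine count_diff _ _ _ v ?_ t
      have := copies_card_mem H e (hH e he) v
      rw [mul_comm, hB]
      exact_mod_cast this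
  obtain ⟨U, hU⟩ := exists_good (p := γ) hγ0.le hγ1 (c := B) (lam := lam) (T := ε * n) hlam0 hlamB
    (univ : Finset (Fin n)) G hGdiff (by
      have e1 : (lam * B) ^ 2 * ((univ : Finset (Fin n)).card : ℝ) - lam * (ε * n)
          = -(ε ^ 2 / (4 * B ^ 2) * n) := by
        rw [Finset.card_univ, Fintype.card_fin, hlam]
        field_simp
        ring
      rw [e1]
      refine lt_of_le_of_lt ?_ (hn₁ n hnn₁)
      gcongr)
  have hE1 : rExp γ (univ : Finset (Fin n)) g1 = γ * n := by
    have := count_exp γ (univ : Finset (Fin n)) (fun v : Fin n => ({v} : Finset (Fin n))) 1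
      (by simp)
    simp only [← card_eq_count] at this
    rw [hg1, this]
    simp
  have hu1 : γ * n - ε * n ≤ U.card := by
    have := hU g1 (by simp [hG])
    rwa [hE1] at this
  have hu2 : (U.card : ℝ) ≤ γ * n + ε * n := by
    have := hU g2 (by simp [hG])
    rw [hg2, rExp_smul, ← hg1, hE1] at this
    linarith
  have hUn : U.card ≤ n := by simpa using Finset.card_le_univ U
  have hεμ : ε ≤ μ := by linarith
  refine ⟨U, ⟨by nlinarith, by nlinarith⟩, ?_, ?_⟩
  · intro F hF hFh
    have hFmem : F ∈ FF := by
      rw [hFF, Finset.mem_biUnion]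
      refine ⟨F.card, by simpa [Nat.lt_succ_iff] using hFh, ?_⟩
      rw [Finset.mem_powersetCard]
      refine ⟨fun f hf => ?_, rfl⟩
      simp [Finset.mem_powersetCard, (hF f hf).1]
    have h1 := hU (gF F) (by
      rw [hG]
      exact Finset.mem_union_right _ (Finset.mem_union_left _ (Finset.mem_image_of_mem _ hFmem)))
    have h2 : rExp γ (univ : Finset (Fin n)) (gF F) = γ * jointDeg H F := by
      simp only [hgF, jointDegIn_eq]
      rw [count_exp γ _ _ 1 (by simp), pow_one]
      rfl
    rw [h2] at h1
    have h3 : (jointDeg H F : ℝ) ≤ n := by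
      have : jointDeg H F ≤ n := by
        unfold jointDeg
        exact (Finset.card_le_univ _).trans (by simp)
      exact_mod_cast this
    have h4 : (jointDeg H F : ℝ) / n * U.card ≤ γ * jointDeg H F + ε * n := by
      have h5 : (jointDeg H F : ℝ) / n * U.card ≤ (jointDeg H F : ℝ) / n * (γ * n + ε * n) := by
        gcongr
      have h6 : (jointDeg H F : ℝ) / n * (γ * n + ε * n)
          = γ * jointDeg H F + ε * jointDeg H F := by field_simp
      have h7 : ε * (jointDeg H F : ℝ) ≤ ε * n := by gcongr
      linarith
    have h8 : 2 * (ε * n) ≤ μ * U.card := by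
      have h9 : μ * (γ * n - ε * n) ≤ μ * U.card := by gcongr
      have h10 : 2 * ε ≤ μ * (γ - ε) := by nlinarith
      have h12 := mul_le_mul_of_nonneg_right h10 hnR.le
      linarith
    have h11 : gF F U = (jointDegIn H F U : ℝ) := rfl
    rw [h11] at h1
    rw [sub_mul]
    linarith
  · intro e he
    have h1 := hU (ge e) (by
      rw [hG]
      exact Finset.mem_union_right _ (Finset.mem_union_right _ (Finset.mem_image_of_mem _ he)))
    have h2 : rExp γ (univ : Finset (Fin n)) (ge e)
        = ((n:ℝ) ^ (k - 1))⁻¹ * (γ ^ k * extCount k H e) := by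
      simp only [hge, extCountIn_eq]
      rw [rExp_smul, count_exp γ _ _ k (copies_sdiff_card H e (hH e he))]
      rfl
    rw [h2] at h1
    have h3 : γ ^ k * extCount k H e - ε * (n:ℝ) ^ k ≤ extCountIn k H e U := by
      have hp : (0:ℝ) < (n:ℝ) ^ (k - 1) := by positivity
      have h4 := mul_le_mul_of_nonneg_left h1 hp.le
      have h5 : (n:ℝ) ^ (k - 1) * n = (n:ℝ) ^ k := by
        rw [← pow_succ]; congr 1; omega
      have h6 : (n:ℝ) ^ (k - 1) * ge e U = extCountIn k H e U := by
        simp only [hge]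
        rw [mul_inv_cancel_left₀ hp.ne']
      rw [h6, mul_sub, mul_inv_cancel_left₀ hp.ne'] at h4
      rw [← h5]
      linarith
    refine numeric_iii k n U.card γ μ ε B _ _ hk hγ0 hγ1 hε0 (by linarith) hμ hB0.le hε3 hn8 hUn
      (by linarith) (by linarith) (Nat.cast_nonneg _) ?_ h3
    have := copies_card H e (hH e he)
    rw [hB]
    exact_mod_cast this
end

section
/- For all integers k ≥ 2 and ℓ ≥ (2k+1)⌊k/2⌋ + 2k, there exists q ≤ ℓ with the following property: for every γ > 0 there exist α > 0 and n_0 such that if H is a k-graph on n ≥ n_0 vertices which is (γn, U)-large for some U ⊆ V(H), and f, f′ are ordered (k−1)-tuples in the ordered shadow of H, then there are at least αn^q walks W in H, each of length ℓ, each with exactly q internal vertices, each going from f to f′, and each with all internal vertices in U and none in f ∪ f′. -/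
open Finset

attribute [local instance] Classical.propDecidable

variable {α : Type*}

/-- `W` is a walk in the `k`-graph `H`: it has at least `k` vertices and every `k` consecutive
vertices are distinct and form an edge of `H`. -/
def IsWalk [DecidableEq α] (k : ℕ) (H : Finset (Finset α)) (W : List α) : Prop :=
  k ≤ W.length ∧ ∀ i, i + k ≤ W.length →
    ((W.drop i).take k).Nodup ∧ ((W.drop i).take k).toFinset ∈ H

/-- `H` is `(ℓ, U)`-large: every two elements of the shadow of `H` have at least `ℓ` common
neighbours in `U`. -/
def IsLargeIn [DecidableEq α] (k : ℕ) (H : Finset (Finset α)) (ℓ : ℝ) (U : Finset α) : Prop :=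
  ∀ f f' : Finset α, InShadow k H f → InShadow k H f' →
    ℓ ≤ ((U.filter fun v => insert v f ∈ H ∧ insert v f' ∈ H).card : ℝ)

/-- A list all of whose windows of size `k` are edges and whose last `k-1` entries are
in the shadow. -/
def GoodList {V : Type*} [DecidableEq V] (k : ℕ) (H : Finset (Finset V)) (W : List V) : Prop :=
  k - 1 ≤ W.length ∧ (∀ i, i + k ≤ W.length → ((W.drop i).take k).toFinset ∈ H) ∧
    InShadow k H (W.drop (W.length - (k - 1))).toFinset

theorem nodup_of_card {V : Type*} [DecidableEq V] (l : List V)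
    (h : l.toFinset.card = l.length) : l.Nodup := by
  have := (Multiset.toFinset_card_eq_card_iff_nodup (m := (l : Multiset V))).1 (by simpa using h)
  simpa using this

theorem GoodList.snoc {V : Type*} [DecidableEq V] {k : ℕ} (hk : 2 ≤ k) {H : Finset (Finset V)}
    (hH : ∀ e ∈ H, e.card = k) {W : List V} (hW : GoodList k H W) {v : V}
    (hv : insert v (W.drop (W.length - (k - 1))).toFinset ∈ H) : GoodList k H (W ++ [v]) := by
  obtain ⟨h1, h2, h3⟩ := hW
  have hdrop : (W ++ [v]).drop (W.length - (k-1)) = W.drop (W.length - (k-1)) ++ [v] := by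
    rw [List.drop_append_of_le_length (by omega)]
  have htf : (W.drop (W.length - (k-1)) ++ [v]).toFinset
      = insert v (W.drop (W.length - (k - 1))).toFinset := by
    ext x; simp [or_comm]
  have hlen : (W.drop (W.length - (k-1)) ++ [v]).length = k := by
    simp; omega
  refine ⟨by simp; omega, ?_, ?_⟩
  · intro i hi
    rw [List.length_append, List.length_singleton] at hi
    by_cases hi' : i + k ≤ W.length
    · rw [List.drop_append_of_le_length (by omega), List.take_append_of_le_length (by simp; omega)]
      exact h2 i hi'
    · have : i = W.length - (k-1) := by omega
      subst this
      rw [hdrop, List.take_of_length_le (by omega), htf]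
      exact hv
  · have hnd : (W.drop (W.length - (k-1)) ++ [v]).Nodup := by
      apply nodup_of_card
      rw [htf, hH _ hv, hlen]
    have he : (W ++ [v]).drop ((W ++ [v]).length - (k-1))
        = (W.drop (W.length - (k-1)) ++ [v]).drop 1 := by
      rw [← hdrop, List.drop_drop]
      congr 1
      simp; omega
    rw [he]
    refine ⟨?_, _, hv, ?_⟩
    · rw [List.toFinset_card_of_nodup (hnd.sublist (List.drop_sublist _ _)), List.length_drop, hlen]
    · rw [← htf]
      intro x hx
      rw [List.mem_toFinset] at hx ⊢
      exact List.mem_of_mem_drop hx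

theorem GoodList.base {V : Type*} [DecidableEq V] {k : ℕ} (hk : 2 ≤ k) {H : Finset (Finset V)}
    {f : List V} (hl : f.length = k - 1) (hs : InShadow k H f.toFinset) : GoodList k H f := by
  refine ⟨hl.ge, fun i hi => by omega, ?_⟩
  rw [hl]; simpa using hs

/-- Counting sequences grown one element at a time. -/
theorem count_grow {V : Type*} [Fintype V] (P : List V → Prop) (x : ℝ) (hx : 0 ≤ x)
    (h0 : P []) (q : ℕ)
    (hs : ∀ l, P l → l.length < q → x ≤ ((Finset.univ.filter fun v => P (l ++ [v])).card : ℝ)) :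
    x ^ q ≤ ((Finset.univ.filter fun y : Fin q → V => P (List.ofFn y)).card : ℝ) := by
  induction q with
  | zero =>
    simp [h0]
  | succ q ih =>
    have ih := ih (fun l hl hlt => hs l hl (by omega))
    set A := Finset.univ.filter fun y : Fin q → V => P (List.ofFn y) with hA
    set B := Finset.univ.filter fun y : Fin (q+1) → V => P (List.ofFn y) with hB
    have key : (A.sigma fun y => Finset.univ.filter fun v => P (List.ofFn y ++ [v])).card
        ≤ B.card := by
      apply Finset.card_le_card_of_injOn
        (fun p => (Fin.snoc p.1 p.2 : Fin (q+1) → V))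
      · rintro ⟨y, v⟩ hp
        simp only [hA, hB, Finset.coe_sigma, Set.mem_sigma_iff, Finset.coe_filter,
          Finset.mem_univ, true_and, Set.mem_ofPred_eq] at hp ⊢
        rw [List.ofFn_succ']
        simpa [List.concat_eq_append] using hp.2
      · rintro ⟨y, v⟩ - ⟨y', v'⟩ - h
        have := Fin.snoc_injective2 h
        obtain ⟨rfl, rfl⟩ := this
        rfl
    have key' : (A.card : ℝ) * x ≤
        ((A.sigma fun y => Finset.univ.filter fun v => P (List.ofFn y ++ [v])).card : ℝ) := by
      rw [Finset.card_sigma]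
      push_cast
      rw [← nsmul_eq_mul]
      apply Finset.card_nsmul_le_sum
      intro y hy
      exact hs _ (by simpa [hA] using hy) (by simp)
    calc x ^ (q+1) = x ^ q * x := pow_succ _ _
      _ ≤ A.card * x := by gcongr
      _ ≤ _ := key'
      _ ≤ _ := by exact_mod_cast key

/-- The admissible choices of internal vertices. -/
def Adm {V : Type*} [DecidableEq V] (k r : ℕ) (H : Finset (Finset V)) (U : Finset V)
    (f f' l : List V) : Prop :=
  l.Nodup ∧ (∀ v ∈ l, v ∈ U ∧ v ∉ f ∧ v ∉ f') ∧ GoodList k H (f ++ l) ∧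
    GoodList k H (f' ++ l.drop r)

theorem adm_step {V : Type*} [DecidableEq V] [Fintype V] {k r : ℕ} (hk : 2 ≤ k)
    {H : Finset (Finset V)} (hH : ∀ e ∈ H, e.card = k) {U : Finset V} {f f' l : List V}
    {g : ℝ} (hU : IsLargeIn k H g U) (hl : Adm k r H U f f' l) :
    g - (l.length + f.length + f'.length) ≤
      ((Finset.univ.filter fun v => Adm k r H U f f' (l ++ [v])).card : ℝ) := by
  obtain ⟨h1, h2, h3, h4⟩ := hl
  have hc := hU _ _ h3.2.2 h4.2.2
  set S := (U.filter fun v => insert v ((f ++ l).drop ((f ++ l).length - (k-1))).toFinset ∈ H ∧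
    insert v ((f' ++ l.drop r).drop ((f' ++ l.drop r).length - (k-1))).toFinset ∈ H) with hS
  have hsub : S \ (l ++ f ++ f').toFinset ⊆
      Finset.univ.filter fun v => Adm k r H U f f' (l ++ [v]) := by
    intro v hv
    simp only [hS, Finset.mem_sdiff, Finset.mem_filter, List.mem_toFinset, List.mem_append,
      not_or] at hv
    obtain ⟨⟨hvU, hv1, hv2⟩, ⟨hvl, hvf⟩, hvf'⟩ := hv
    simp only [Finset.mem_filter, Finset.mem_univ, true_and]
    refine ⟨?_, ?_, ?_, ?_⟩
    · rw [List.nodup_append]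
      refine ⟨h1, by simp, ?_⟩
      intro a ha b hb hab
      simp only [List.mem_singleton] at hb
      subst hb; subst hab; exact hvl ha
    · intro w hw
      rw [List.mem_append, List.mem_singleton] at hw
      rcases hw with hw | rfl
      · exact h2 w hw
      · exact ⟨hvU, hvf, hvf'⟩
    · rw [← List.append_assoc]
      exact h3.snoc hk hH hv1
    · by_cases hr : r ≤ l.length
      · rw [List.drop_append_of_le_length hr, ← List.append_assoc]
        exact h4.snoc hk hH hv2
      · rw [List.drop_of_length_le (by simp; omega)]
        rwa [List.drop_of_length_le (by omega)] at h4
  have hcard := Finset.card_le_card hsub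
  have h5 := Finset.le_card_sdiff (l ++ f ++ f').toFinset S
  have h6 : (l ++ f ++ f').toFinset.card ≤ l.length + f.length + f'.length := by
    refine (List.toFinset_card_le _).trans ?_
    simp; omega
  have h7 : S.card ≤ (Finset.univ.filter fun v => Adm k r H U f f' (l ++ [v])).card
    + (l.length + f.length + f'.length) := by omega
  have h8 : (S.card : ℝ) ≤ (Finset.univ.filter fun v => Adm k r H U f f' (l ++ [v])).card
    + (l.length + f.length + f'.length) := by exact_mod_cast h7
  linarith

/-- The entry of the walk at position `p`. -/
def walkFn {V : Type*} (k r : ℕ) (x0 : V) (f f' y : List V) (p : ℕ) : V :=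
  if p < r + k then (f ++ y).getD p x0
  else if (p - r) % k = k - 1 then y.getD r x0
  else if (p - r) / k + (p - r) % k < k then y.getD (r + (p - r) % k + 1) x0
  else f'.getD ((p - r) % k) x0

theorem walkFn_slot {V : Type*} {k r : ℕ} (hk : 2 ≤ k) (x0 : V) (f f' y : List V) (t s : ℕ)
    (ht : 1 ≤ t) (hs : s < k) :
    walkFn k r x0 f f' y (r + (t * k + s)) =
      if s = k - 1 then y.getD r x0
      else if t + s < k then y.getD (r + s + 1) x0 else f'.getD s x0 := by
  have h1 : ¬ (r + (t * k + s) < r + k) := by nlinarith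
  have h2 : r + (t * k + s) - r = s + k * t := by rw [mul_comm k t]; omega
  have h3 : (s + k * t) % k = s := by
    rw [Nat.add_mul_mod_self_left, Nat.mod_eq_of_lt hs]
  have h4 : (s + k * t) / k = t := by
    rw [Nat.add_mul_div_left _ _ (by omega), Nat.div_eq_of_lt hs, zero_add]
  unfold walkFn
  rw [if_neg h1, h2, h3, h4]

theorem walkFn_init {V : Type*} {k r : ℕ} (hk : 2 ≤ k) (x0 : V) (f f' y : List V)
    (hf : f.length = k - 1) (p : ℕ) (hp : p < r + 2 * k - 1) :
    walkFn k r x0 f f' y p = (f ++ y).getD p x0 := by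
  by_cases h : p < r + k
  · unfold walkFn; rw [if_pos h]
  · obtain ⟨s, rfl⟩ : ∃ s, p = r + (1 * k + s) := ⟨p - r - k, by omega⟩
    rw [walkFn_slot hk x0 f f' y 1 s le_rfl (by omega), if_neg (by omega), if_pos (by omega),
      List.getD_append_right _ _ _ _ (by omega)]
    congr 1; omega

theorem mem_window {V : Type*} {N : ℕ} (g : ℕ → V) (i k : ℕ) (x : V) (hN : i + k ≤ N) :
    (∃ p, i ≤ p ∧ p < i + k ∧ g p = x) →
      x ∈ ((List.ofFn (fun j : Fin N => g j)).drop i).take k := by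
  rintro ⟨p, h1, h2, rfl⟩
  rw [List.mem_iff_getElem]
  refine ⟨p - i, by simp; omega, ?_⟩
  simp only [List.getElem_take, List.getElem_drop, List.getElem_ofFn]
  congr 1; omega

theorem mem_of_window {V : Type*} (x0 : V) (W : List V) (i k : ℕ) (x : V)
    (h : x ∈ (W.drop i).take k) : ∃ p, i ≤ p ∧ p < i + k ∧ p < W.length ∧ W.getD p x0 = x := by
  rw [List.mem_iff_getElem] at h
  obtain ⟨m, hm, rfl⟩ := h
  simp only [List.length_take, List.length_drop] at hm
  refine ⟨i + m, by omega, by omega, by omega, ?_⟩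
  rw [List.getD_eq_getElem _ _ (by omega)]
  simp

theorem walkFn_window {V : Type*} [DecidableEq V] {k r : ℕ} (hk : 2 ≤ k)
    {H : Finset (Finset V)} (hH : ∀ e ∈ H, e.card = k) (x0 : V) {U : Finset V} {f f' y : List V}
    (hf : f.length = k - 1) (hf' : f'.length = k - 1) (hy : y.length = r + k)
    (hA : Adm k r H U f f' y) (i N : ℕ) (hN : N = r + k * k + k - 1) (hi : i + k ≤ N) :
    (((List.ofFn (fun j : Fin N => walkFn k r x0 f f' y j)).drop i).take k).Nodup ∧
    (((List.ofFn (fun j : Fin N => walkFn k r x0 f f' y j)).drop i).take k).toFinset ∈ H := by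
  set G := ((List.ofFn (fun j : Fin N => walkFn k r x0 f f' y j)).drop i).take k with hG
  have hGl : G.length = k := by simp [hG]; omega
  suffices h : ∃ e ∈ H, e ⊆ G.toFinset by
    obtain ⟨e, he, hs⟩ := h
    have h1 := List.toFinset_card_le G
    have h2 := hH e he
    have h3 : e = G.toFinset := Finset.eq_of_subset_of_card_le hs (by omega)
    rw [← h3]
    refine ⟨nodup_of_card _ ?_, he⟩
    rw [← h3]; omega
  obtain ⟨-, -, hg1, hg2⟩ := hA
  by_cases hir : i < r + k
  · refine ⟨_, hg1.2.1 i (by simp; omega), ?_⟩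
    intro x hx
    rw [List.mem_toFinset] at hx ⊢
    obtain ⟨p, hp1, hp2, hp3, rfl⟩ := mem_of_window x0 _ _ _ _ hx
    exact mem_window (walkFn k r x0 f f' y) i k _ hi
      ⟨p, hp1, hp2, walkFn_init hk x0 f f' y hf p (by omega)⟩
  · obtain ⟨t, s, ht, hs, rfl⟩ : ∃ t s, 1 ≤ t ∧ s < k ∧ i = r + (t * k + s) := by
      refine ⟨(i - r) / k, (i - r) % k, ?_, Nat.mod_lt _ (by omega), ?_⟩
      · rw [Nat.le_div_iff_mul_le (by omega)]; omega
      · rw [mul_comm, Nat.div_add_mod]; omega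
    have htk : t < k := by
      by_contra hcon
      have : k * k ≤ t * k := Nat.mul_le_mul_right _ (by omega)
      omega
    -- slot values
    have slot : ∀ u, u < k → ∀ x, (∀ t', (t' = if s ≤ u then t else t + 1) →
        (if u = k - 1 then y.getD r x0
          else if t' + u < k then y.getD (r + u + 1) x0 else f'.getD u x0) = x) →
        x ∈ G := by
      intro u hu x hx
      have := hx _ rfl
      apply mem_window (walkFn k r x0 f f' y) _ k _ hi
      by_cases hsu : s ≤ u
      · refine ⟨r + (t * k + u), by omega, by omega, ?_⟩
        rw [walkFn_slot hk x0 f f' y t u ht hu]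
        simpa [hsu] using this
      · refine ⟨r + ((t + 1) * k + u), by rw [add_mul]; omega, by rw [add_mul]; omega, ?_⟩
        rw [walkFn_slot hk x0 f f' y (t+1) u (by omega) hu]
        simpa [hsu] using this
    obtain ⟨j, hj⟩ : ∃ j, j = if s + t < k then k - t else k - 1 - t := ⟨_, rfl⟩
    have hjk : j ≤ k - 1 := by split_ifs at hj <;> omega
    refine ⟨_, hg2.2.1 j (by simp; omega), ?_⟩
    intro x hx
    rw [List.mem_toFinset] at hx ⊢
    obtain ⟨p, hp1, hp2, hp3, rfl⟩ := mem_of_window x0 _ _ _ _ hx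
    by_cases hpk : p < k - 1
    · apply slot p (by omega)
      intro t' ht'
      rw [if_neg (by omega), if_neg, List.getD_append _ _ _ _ (by omega)]
      split_ifs at ht' hj <;> omega
    · have hval : (f' ++ y.drop r).getD p x0 = y.getD (r + (p - (k - 1))) x0 := by
        rw [List.getD_append_right _ _ _ _ (by omega), hf']
        simp [List.getD_eq_getElem?_getD]
      rw [hval]
      by_cases hp0 : p = k - 1
      · apply slot (k-1) (by omega)
        intro t' ht'
        rw [if_pos rfl]
        congr 1; omega
      · apply slot (p - k) (by omega)
        intro t' ht'
        rw [if_neg (by omega), if_pos]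
        · congr 1; omega
        · split_ifs at ht' hj <;> omega

theorem walkFn_mem {V : Type*} {k r : ℕ} (hk : 2 ≤ k) (x0 : V) {f f' y : List V}
    (hf : f.length = k - 1) (hf' : f'.length = k - 1) (hy : y.length = r + k) (p : ℕ) :
    walkFn k r x0 f f' y p ∈ f ∨ walkFn k r x0 f f' y p ∈ f' ∨ walkFn k r x0 f f' y p ∈ y := by
  have gm : ∀ (l : List V) (m : ℕ), m < l.length → l.getD m x0 ∈ l := by
    intro l m hm
    rw [List.getD_eq_getElem _ _ hm]; exact List.getElem_mem hm
  have hmod : (p - r) % k < k := Nat.mod_lt _ (by omega)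
  unfold walkFn
  split_ifs with h1 h2 h3
  · have := gm (f ++ y) p (by simp; omega)
    rw [List.mem_append] at this
    tauto
  · right; right; exact gm _ _ (by omega)
  · right; right; exact gm _ _ (by omega)
  · right; left; exact gm _ _ (by omega)

theorem connecting_core {V : Type*} [DecidableEq V] [Fintype V] {k r : ℕ} (hk : 2 ≤ k)
    {H : Finset (Finset V)} (hH : ∀ e ∈ H, e.card = k) (x0 : V) {U : Finset V} {f f' y : List V}
    (hf : f.length = k - 1) (hf' : f'.length = k - 1) (hy : y.length = r + k)
    (hA : Adm k r H U f f' y) (ℓ : ℕ) (hl : ℓ = r + k * k)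
    (W : List V) (hW : W = List.ofFn (fun j : Fin (ℓ + k - 1) => walkFn k r x0 f f' y j)) :
    IsWalk k H W ∧ W.take (k - 1) = f ∧ W.drop ℓ = f' ∧
      (W.toFinset \ (f.toFinset ∪ f'.toFinset)).card = r + k ∧
      W.toFinset \ (f.toFinset ∪ f'.toFinset) ⊆ U := by
  have hkk : 2 * k ≤ k * k := Nat.mul_le_mul_right _ hk
  have hWl : W.length = ℓ + k - 1 := by simp [hW]
  have hWg : ∀ p (h : p < W.length), W[p] = walkFn k r x0 f f' y p := by
    intro p h; subst hW; simp
  have hset : W.toFinset \ (f.toFinset ∪ f'.toFinset) = y.toFinset := by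
    ext x
    simp only [Finset.mem_sdiff, List.mem_toFinset, Finset.mem_union, not_or]
    constructor
    · rintro ⟨hx, h1, h2⟩
      obtain ⟨p, hp, rfl⟩ := List.mem_iff_getElem.1 hx
      rw [hWg] at h1 h2 ⊢
      rcases walkFn_mem hk x0 hf hf' hy p with h | h | h
      · exact absurd h h1
      · exact absurd h h2
      · exact h
    · intro hx
      refine ⟨?_, (hA.2.1 x hx).2⟩
      obtain ⟨m, hm, rfl⟩ := List.mem_iff_getElem.1 hx
      rw [List.mem_iff_getElem]
      refine ⟨k - 1 + m, by omega, ?_⟩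
      rw [hWg, walkFn_init hk x0 f f' y hf _ (by omega),
        List.getD_append_right _ _ _ _ (by omega), hf, Nat.add_sub_cancel_left,
        List.getD_eq_getElem _ _ hm]
  refine ⟨⟨by omega, ?_⟩, ?_, ?_, ?_, ?_⟩
  · intro i hi
    rw [hWl] at hi
    rw [hW]
    exact walkFn_window hk hH x0 hf hf' hy hA i (ℓ + k - 1) (by omega) hi
  · apply List.ext_getElem
    · simp; omega
    · intro m h1 h2
      rw [List.getElem_take, hWg, walkFn_init hk x0 f f' y hf _ (by omega),
        List.getD_append _ _ _ _ h2, List.getD_eq_getElem _ _ h2]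
  · apply List.ext_getElem
    · simp; omega
    · intro m h1 h2
      rw [List.getElem_drop, hWg]
      have : ℓ + m = r + (k * k + m) := by omega
      rw [this, walkFn_slot hk x0 f f' y k m (by omega) (by omega), if_neg (by omega),
        if_neg (by omega), List.getD_eq_getElem _ _ h2]
  · rw [hset, List.toFinset_card_of_nodup hA.1, hy]
  · rw [hset]
    intro x hx
    exact (hA.2.1 x (List.mem_toFinset.1 hx)).1

theorem connecting_count {V : Type*} [DecidableEq V] [Fintype V] {k r : ℕ} (hk : 2 ≤ k)
    {H : Finset (Finset V)} (hH : ∀ e ∈ H, e.card = k) {U : Finset V} {f f' : List V}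
    (hf : f.length = k - 1) (hf' : f'.length = k - 1)
    (hs : InShadow k H f.toFinset) (hs' : InShadow k H f'.toFinset)
    {g : ℝ} (hU : IsLargeIn k H g U) (x : ℝ) (hx : 0 ≤ x)
    (hxg : x + (r + k + (k - 1) + (k - 1)) ≤ g) (ℓ : ℕ) (hl : ℓ = r + k * k)
    (Q : (Fin (ℓ + k - 1) → V) → Prop) [DecidablePred Q]
    (hQ : ∀ w : Fin (ℓ + k - 1) → V, (IsWalk k H (List.ofFn w) ∧
      (List.ofFn w).take (k - 1) = f ∧ (List.ofFn w).drop ℓ = f' ∧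
      ((List.ofFn w).toFinset \ (f.toFinset ∪ f'.toFinset)).card = r + k ∧
      (List.ofFn w).toFinset \ (f.toFinset ∪ f'.toFinset) ⊆ U) → Q w) :
    x ^ (r + k) ≤ ((Finset.univ.filter Q).card : ℝ) := by
  have hkk : 2 * k ≤ k * k := Nat.mul_le_mul_right _ hk
  have hk1 : ((k - 1 : ℕ) : ℝ) = (k : ℝ) - 1 := by
    rw [Nat.cast_sub (by omega)]; simp
  have h0 : Adm k r H U f f' [] := by
    refine ⟨by simp, by simp, ?_, ?_⟩
    · simpa using GoodList.base hk hf hs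
    · simpa using GoodList.base hk hf' hs'
  have h1 := count_grow (Adm k r H U f f') x hx h0 (r + k) (by
    intro l hl hlt
    refine le_trans ?_ (adm_step hk hH hU hl)
    rw [hf, hf', hk1]
    have : (l.length : ℝ) ≤ r + k := by exact_mod_cast hlt.le
    linarith)
  refine h1.trans ?_
  obtain ⟨x0, -⟩ : ∃ x0, x0 ∈ f := List.exists_mem_of_length_pos (by omega)
  norm_cast
  apply Finset.card_le_card_of_injOn
    (fun y => fun j : Fin (ℓ + k - 1) => walkFn k r x0 f f' (List.ofFn y) j)
  · intro y hy
    simp only [Finset.coe_filter, Finset.mem_univ, true_and, Set.mem_ofPred_eq] at hy ⊢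
    apply hQ
    exact connecting_core hk hH x0 hf hf' (by simp) hy ℓ hl _ rfl
  · intro y _ y' _ h
    funext m
    have hm := m.2
    have h2 := congrFun h ⟨k - 1 + m, by omega⟩
    simp only at h2
    rw [walkFn_init hk x0 f f' _ hf _ (by omega), walkFn_init hk x0 f f' _ hf _ (by omega),
      List.getD_append_right _ _ _ _ (by omega), List.getD_append_right _ _ _ _ (by omega), hf,
      Nat.add_sub_cancel_left, List.getD_eq_getElem _ _ (by simp),
      List.getD_eq_getElem _ _ (by simp)] at h2
    simpa using h2

/-- **Connecting Lemma.** For all `k ≥ 2` and `ℓ ≥ (2k+1)⌊k/2⌋ + 2k` there is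
`q ≤ ℓ` such that for every `γ > 0` there are `α > 0` and `n₀` with the following property: if
`H` is a `k`-graph on `n ≥ n₀` vertices which is `(γn, U)`-large for some `U ⊆ V(H)`, and
`f, f'` are ordered tuples in the ordered shadow of `H`, then there are at least `α n^q` walks
of length `ℓ`, each with exactly `q` internal vertices, going from `f` to `f'`, all of whose
internal vertices lie in `U` and avoid `f ∪ f'`. -/
theorem connecting_lemma (k ℓ : ℕ) (hk : 2 ≤ k) (hℓ : (2 * k + 1) * (k / 2) + 2 * k ≤ ℓ) :
    ∃ q : ℕ, q ≤ ℓ ∧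
      ∀ γ : ℝ, 0 < γ →
      ∃ (a : ℝ) (n₀ : ℕ), 0 < a ∧
        ∀ n : ℕ, n₀ ≤ n →
        ∀ H : Finset (Finset (Fin n)), (∀ e ∈ H, e.card = k) →
        ∀ U : Finset (Fin n), IsLargeIn k H (γ * n) U →
        ∀ f f' : List (Fin n),
          f.length = k - 1 → f.Nodup → InShadow k H f.toFinset →
          f'.length = k - 1 → f'.Nodup → InShadow k H f'.toFinset →
          a * (n : ℝ) ^ q ≤
            ((Finset.univ.filter fun g : Fin (ℓ + k - 1) → Fin n =>
              IsWalk k H (List.ofFn g) ∧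
              (List.ofFn g).take (k - 1) = f ∧
              (List.ofFn g).drop ℓ = f' ∧
              ((List.ofFn g).toFinset \ (f.toFinset ∪ f'.toFinset)).card = q ∧
              (List.ofFn g).toFinset \ (f.toFinset ∪ f'.toFinset) ⊆ U).card : ℝ) := by
  have hkl : k * k ≤ ℓ := by
    obtain ⟨m, rfl | rfl⟩ := Nat.even_or_odd' k
    · have : 2 * m / 2 = m := by omega
      rw [this] at hℓ
      nlinarith
    · have : (2 * m + 1) / 2 = m := by omega
      rw [this] at hℓ
      nlinarith
  obtain ⟨r, rfl⟩ : ∃ r, ℓ = r + k * k := ⟨ℓ - k * k, by omega⟩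
  have hkk : 2 * k ≤ k * k := Nat.mul_le_mul_right _ hk
  refine ⟨r + k, by omega, ?_⟩
  intro γ hγ
  refine ⟨(γ / 2) ^ (r + k), ⌈2 * ((r : ℝ) + 3 * k) / γ⌉₊, by positivity, ?_⟩
  intro n hn H hH U hU f f' hf hfn hs hf' hfn' hs'
  have hn' : 2 * ((r : ℝ) + 3 * k) / γ ≤ n := Nat.ceil_le.1 hn
  rw [div_le_iff₀ hγ] at hn'
  rw [← mul_pow]
  exact connecting_count hk hH hf hf' hs hs' hU (γ / 2 * n) (by positivity) (by nlinarith) _ rfl _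
    (fun w hw => hw)
end
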